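/- Let X be a non-degenerate self-decomposable random vector in ℝ^d without Gaussian component, with characteristic function φ, law μ_X, and Lévy measure ν(du) = 1_{(0,∞)}(r)1_{S^{d−1}}(x)(k_x(r)/r) dr σ(dx), where σ is a finite positive measure on S^{d−1} and k_x(r) ≥ 0 is nonincreasing and continuous in r ∈ (0,∞), continuous in x ∈ S^{d−1}, with lim_{r→0⁺} r²k_x(r) = 0 and lim_{r→∞} k_x(r) = 0. Assume: (a) there is ε ∈ (0,1) with E‖X‖^ε < ∞; (b) there exist β₁, β₂ > 0 and β₃ ∈ (0,1) with γ₁ = sup_{t≥0} e^{β₁t} ∫_{(1,∞)×S^{d−1}} (k_x(e^t r)/r) dr σ(dx) < ∞, γ₂ = sup_{t≥0} e^{β₂t} ∫_{(0,1)×S^{d−1}} r k_x(e^t r) dr σ(dx) < ∞, and γ₃ = sup_{t≥0} e^{−(1−β₃)t} ‖∫_{S^{d−1}} x (∫_1^{e^t} k_x(r) dr) σ(dx)‖ < ∞; (c) sup_{t≥0} E‖X_t‖^ε < ∞, where X_t has characteristic function φ(ξ)/φ(e^{−t}ξ). Let P_t^ν(h)(x) = ∫ h(xe^{−t}+y) μ_t(dy)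 with μ_t the law of X_t. Then: (1) for every h ∈ H₁ the function f_h(x) = −∫_0^∞ (P_t^ν(h)(x) − E h(X)) dt is well defined and continuously differentiable on ℝ^d with M₁(f_h) ≤ 1; (2) for every h ∈ H₂ ∩ C_c^∞(ℝ^d), f_h is twice continuously differentiable with M₂(f_h) ≤ 1/2 and satisfies, for all x ∈ ℝ^d, ⟨b̃ − x, ∇f_h(x)⟩ + ∫_{ℝ^d} ( f_h(x+u) − f_h(x) − ⟨∇f_h(x), u⟩1_{‖u‖≤1} ) ν̃(du) = h(x) − E h(X), where b̃ = b − ∫_{S^{d−1}} k_y(1) y σ(dy) and b is the parameter in the Lévy–Khintchine representation of φ. -/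

import Mathlib

open MeasureTheory ProbabilityTheory Filter Set
open scoped RealInnerProductSpace ENNReal NNReal Topology

noncomputable section

/-- The characteristic function of a measure on `ℝ^d`. -/
def charFn {d : ℕ} (μ : Measure (EuclideanSpace ℝ (Fin d)))
    (ξ : EuclideanSpace ℝ (Fin d)) : ℂ :=
  ∫ x, Complex.exp (Complex.I * (⟪ξ, x⟫ : ℂ)) ∂μ

/-- The semigroup of operators `P_t^ν(h)(x) = ∫ h(x e^{−t} + y) μ_t(dy)`. -/
def Pop {d : ℕ} (μt : ℝ → Measure (EuclideanSpace ℝ (Fin d)))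
    (h : EuclideanSpace ℝ (Fin d) → ℝ) (t : ℝ) (x : EuclideanSpace ℝ (Fin d)) : ℝ :=
  ∫ y, h (Real.exp (-t) • x + y) ∂(μt t)

/-- The candidate solution `f_h(x) = −∫_0^∞ (P_t^ν(h)(x) − E h(X)) dt` of the Stein equation. -/
def steinSol {d : ℕ} (μX : Measure (EuclideanSpace ℝ (Fin d)))
    (μt : ℝ → Measure (EuclideanSpace ℝ (Fin d)))
    (h : EuclideanSpace ℝ (Fin d) → ℝ) (x : EuclideanSpace ℝ (Fin d)) : ℝ :=
  -∫ t in Ioi (0 : ℝ), (Pop μt h t x - ∫ y, h y ∂μX)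

set_option linter.unusedSectionVars false

section Semigroup

variable {E : Type*} [NormedAddCommGroup E] [InnerProductSpace ℝ E] [FiniteDimensional ℝ E]
  [MeasurableSpace E] [BorelSpace E]

/-- A family of probability measures whose characteristic functions are continuous in the
parameter `t ≥ 0` is the restriction of a Markov kernel. -/
lemma exists_kernel_of_continuousOn_charFun (m : ℝ → Measure E)
    (hm : ∀ t, 0 ≤ t → IsProbabilityMeasure (m t))
    (hc : ∀ ξ, ContinuousOn (fun t => charFun (m t) ξ) (Ici 0)) :
    ∃ κ : Kernel ℝ E, IsMarkovKernel κ ∧ ∀ t, 0 ≤ t → κ t = m t := by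
  have hp : ∀ t : ℝ, IsProbabilityMeasure (m (max t 0)) := fun t => hm _ (le_max_right _ _)
  let P : ℝ → ProbabilityMeasure E := fun t => ⟨m (max t 0), hp t⟩
  have hPc : Continuous P := by
    rw [continuous_iff_seqContinuous]
    intro u t hu
    apply ProbabilityMeasure.tendsto_of_tendsto_charFun
    intro ξ
    have h2 : Continuous fun t : ℝ => charFun (m (max t 0)) ξ :=
      (hc ξ).comp_continuous (by fun_prop) (fun t => mem_Ici.2 (le_max_right _ _))
    exact (h2.tendsto t).comp hu
  have hmeas : Measurable fun t : ℝ => m (max t 0) := by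
    refine Measurable.measure_of_isPiSystem_of_isProbabilityMeasure
      (BorelSpace.measurable_eq.trans borel_eq_generateFrom_isClosed) isPiSystem_isClosed ?_
    intro F hF
    have hF' : IsClosed F := hF
    refine measurable_of_tendsto_metrizable (f := fun n t => ∫⁻ x, hF'.apprSeq n x ∂m (max t 0))
      (fun n => ?_) ?_
    · refine Continuous.measurable ?_
      rw [continuous_iff_continuousAt]
      intro t
      exact (ProbabilityMeasure.tendsto_iff_forall_lintegral_tendsto.1 (hPc.tendsto t)) _
    · rw [tendsto_pi_nhds]
      intro t
      exact HasOuterApproxClosed.tendsto_lintegral_apprSeq hF' _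
  refine ⟨⟨fun t => m (max t 0), hmeas⟩, ⟨fun t => hp t⟩, fun t ht => ?_⟩
  change m (max t 0) = m t
  rw [max_eq_left ht]

variable (κ : Kernel ℝ E) [IsMarkovKernel κ]

/-- The joint law of `(t, X_t)`, with `t` distributed according to Lebesgue measure on the
positive half-line. -/
abbrev timeLaw : Measure (ℝ × E) := (volume.restrict (Ioi (0 : ℝ))) ⊗ₘ κ

lemma map_fst_timeLaw : (timeLaw κ).map Prod.fst = volume.restrict (Ioi (0 : ℝ)) :=
  Measure.fst_compProd _ _

lemma integrable_timeLaw_comp_fst {F : Type*} [NormedAddCommGroup F] {g : ℝ → F}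
    (hg : IntegrableOn g (Ioi 0)) : Integrable (fun p => g p.1) (timeLaw κ) := by
  rw [IntegrableOn, ← map_fst_timeLaw κ] at hg
  exact hg.comp_measurable measurable_fst

lemma integral_timeLaw_comp_fst {F : Type*} [NormedAddCommGroup F] [NormedSpace ℝ F] {g : ℝ → F}
    (hg : IntegrableOn g (Ioi 0)) : ∫ p, g p.1 ∂timeLaw κ = ∫ t in Ioi 0, g t := by
  rw [← map_fst_timeLaw κ, integral_map measurable_fst.aemeasurable]
  rw [map_fst_timeLaw]
  exact hg.aestronglyMeasurable

lemma ae_timeLaw_pos : ∀ᵐ p ∂timeLaw κ, 0 < p.1 := by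
  have h := ae_restrict_mem (μ := volume) (measurableSet_Ioi (a := (0 : ℝ)))
  rw [← map_fst_timeLaw κ] at h
  exact ae_of_ae_map measurable_fst.aemeasurable h

lemma integrableOn_exp_neg_mul {a : ℝ} (ha : 0 < a) :
    IntegrableOn (fun t : ℝ => Real.exp (-a * t)) (Ioi 0) :=
  exp_neg_integrableOn_Ioi 0 ha

lemma integral_exp_neg_mul {a : ℝ} (ha : 0 < a) :
    ∫ t in Ioi (0 : ℝ), Real.exp (-a * t) = 1 / a := by
  rw [integral_exp_mul_Ioi (by linarith) 0]
  simp

variable {F : Type*} [NormedAddCommGroup F] [NormedSpace ℝ F]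

lemma aestronglyMeasurable_exp_smul {G : E → F} (hG : Continuous G) (a : ℝ) (x : E) :
    AEStronglyMeasurable
      (fun p : ℝ × E => Real.exp (-a * p.1) • G (Real.exp (-p.1) • x + p.2)) (timeLaw κ) :=
  Continuous.aestronglyMeasurable (by fun_prop)

lemma norm_exp_smul_le {G : E → F} {M : ℝ} (hM : ∀ x, ‖G x‖ ≤ M) (a t : ℝ) (y : E) :
    ‖Real.exp (-a * t) • G y‖ ≤ Real.exp (-a * t) * M := by
  rw [norm_smul, Real.norm_eq_abs, Real.abs_exp]
  exact mul_le_mul_of_nonneg_left (hM _) (Real.exp_pos _).le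

lemma integrable_exp_smul {G : E → F} (hG : Continuous G) {M : ℝ} (hM : ∀ x, ‖G x‖ ≤ M)
    {a : ℝ} (ha : 0 < a) (x : E) :
    Integrable (fun p : ℝ × E => Real.exp (-a * p.1) • G (Real.exp (-p.1) • x + p.2))
      (timeLaw κ) :=
  (integrable_timeLaw_comp_fst κ ((integrableOn_exp_neg_mul ha).mul_const M)).mono'
    (aestronglyMeasurable_exp_smul κ hG a x) (ae_of_all _ fun _ => norm_exp_smul_le hM _ _ _)

lemma norm_integral_exp_smul_le {G : E → F} {M : ℝ} (hM : ∀ x, ‖G x‖ ≤ M)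
    {a : ℝ} (ha : 0 < a) (x : E) :
    ‖∫ p, Real.exp (-a * p.1) • G (Real.exp (-p.1) • x + p.2) ∂timeLaw κ‖ ≤ M / a := by
  have hi := (integrableOn_exp_neg_mul ha).mul_const M
  refine (norm_integral_le_of_norm_le (integrable_timeLaw_comp_fst κ hi)
    (ae_of_all _ fun _ => norm_exp_smul_le hM _ _ _)).trans ?_
  rw [integral_timeLaw_comp_fst κ hi, integral_mul_const, integral_exp_neg_mul ha]
  exact le_of_eq (by ring)

lemma continuous_integral_exp_smul {G : E → F} (hG : Continuous G) {M : ℝ}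
    (hM : ∀ x, ‖G x‖ ≤ M) {a : ℝ} (ha : 0 < a) :
    Continuous fun x => ∫ p, Real.exp (-a * p.1) • G (Real.exp (-p.1) • x + p.2) ∂timeLaw κ :=
  continuous_of_dominated (fun x => aestronglyMeasurable_exp_smul κ hG a x)
    (fun _ => ae_of_all _ fun p => norm_exp_smul_le hM _ _ _)
    (integrable_timeLaw_comp_fst κ ((integrableOn_exp_neg_mul ha).mul_const M))
    (ae_of_all _ fun _ => by fun_prop)

/-- Differentiation under the integral sign along the semigroup: each derivative in space
improves the exponential weight by a factor `e^{-t}`. -/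
lemma hasFDerivAt_integral_exp_smul {G : E → F} (hG : ContDiff ℝ 1 G) {M : ℝ}
    (hM : ∀ x, ‖fderiv ℝ G x‖ ≤ M) {a : ℝ} (ha : 0 ≤ a) {c : ℝ × E → F}
    (hηi : ∀ x, Integrable
      (fun p : ℝ × E => Real.exp (-a * p.1) • G (Real.exp (-p.1) • x + p.2) - c p)
      (timeLaw κ)) (x : E) :
    HasFDerivAt
      (fun x => ∫ p, (Real.exp (-a * p.1) • G (Real.exp (-p.1) • x + p.2) - c p) ∂timeLaw κ)
      (∫ p, Real.exp (-(a + 1) * p.1) • fderiv ℝ G (Real.exp (-p.1) • x + p.2) ∂timeLaw κ) x := by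
  have ha1 : 0 < a + 1 := by linarith
  refine hasFDerivAt_integral_of_dominated_of_fderiv_le (s := univ)
    (F' := fun x p => Real.exp (-(a + 1) * p.1) • fderiv ℝ G (Real.exp (-p.1) • x + p.2))
    (bound := fun p => Real.exp (-(a + 1) * p.1) * M) univ_mem
    (Eventually.of_forall fun x => (hηi x).aestronglyMeasurable) (hηi x)
    (aestronglyMeasurable_exp_smul κ (hG.continuous_fderiv one_ne_zero) _ x)
    (ae_of_all _ fun p x _ => norm_exp_smul_le hM _ _ _)
    (integrable_timeLaw_comp_fst κ ((integrableOn_exp_neg_mul ha1).mul_const M))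
    (ae_of_all _ fun p x _ => ?_)
  have h1 : HasFDerivAt (fun x : E => Real.exp (-p.1) • x + p.2)
      (Real.exp (-p.1) • ContinuousLinearMap.id ℝ E) x :=
    ((hasFDerivAt_id x).const_smul _).add_const _
  have h2 := ((((hG.differentiable one_ne_zero) _).hasFDerivAt.comp x h1).const_smul
    (Real.exp (-a * p.1))).sub_const (c p)
  refine h2.congr_fderiv ?_
  ext v
  simp only [_root_.smul_apply, ContinuousLinearMap.comp_apply,
    ContinuousLinearMap.id_apply, map_smul, smul_smul]
  rw [← Real.exp_add]
  ring_nf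

end Semigroup

section Regularity

lemma min_two_le_rpow {s ε : ℝ} (hs : 0 ≤ s) (hε : ε ∈ Ioo (0 : ℝ) 1) :
    min 2 s ≤ 2 * s ^ ε := by
  rcases le_total s 1 with h | h
  · have h1 : s ≤ s ^ ε := by
      simpa using Real.rpow_le_rpow_of_exponent_ge_of_imp hs h hε.2.le (by simp)
    exact (min_le_right _ _).trans (by linarith [Real.rpow_nonneg hs ε])
  · have h1 : 1 ≤ s ^ ε := Real.one_le_rpow h hε.1.le
    exact (min_le_left _ _).trans (by linarith)

variable {d : ℕ} {μX : Measure (EuclideanSpace ℝ (Fin d))} [IsProbabilityMeasure μX]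
  {μt : ℝ → Measure (EuclideanSpace ℝ (Fin d))} {h : EuclideanSpace ℝ (Fin d) → ℝ}
  {ε : ℝ}

lemma abs_sub_le_min_of_fderiv (hd : ContDiff ℝ 1 h) (h0 : ∀ x, |h x| ≤ 1)
    (h1 : ∀ x, ‖fderiv ℝ h x‖ ≤ 1) (x y : EuclideanSpace ℝ (Fin d)) :
    |h x - h y| ≤ min 2 ‖x - y‖ := by
  refine le_min ?_ ?_
  · have := abs_le.1 (h0 x)
    have := abs_le.1 (h0 y)
    exact abs_le.2 ⟨by linarith, by linarith⟩
  · simpa using Convex.norm_image_sub_le_of_norm_fderiv_le (𝕜 := ℝ) (f := h) (s := univ) (C := 1)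
      (fun z _ => (hd.differentiable one_ne_zero) z) (fun z _ => h1 z) convex_univ
      (mem_univ y) (mem_univ x)

lemma integrable_of_continuous_of_abs_le {E : Type*} [TopologicalSpace E]
    [SecondCountableTopology E] [MeasurableSpace E] [OpensMeasurableSpace E]
    {μ : Measure E} [IsFiniteMeasure μ]
    {g : E → ℝ} {C : ℝ} (hg : Continuous g) (hC : ∀ x, |g x| ≤ C) : Integrable g μ :=
  (integrable_const C).mono' hg.aestronglyMeasurable (ae_of_all _ hC)

/-- Exponential convergence of the semigroup towards its invariant measure. -/
lemma abs_Pop_sub_integral_le {t : ℝ} [IsProbabilityMeasure (μt t)]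
    (hself : μX.map (fun z => Real.exp (-t) • z) ∗ μt t = μX)
    (hε : ε ∈ Ioo (0 : ℝ) 1) (hmom : Integrable (fun z => ‖z‖ ^ ε) μX)
    (hd : ContDiff ℝ 1 h) (h0 : ∀ x, |h x| ≤ 1) (h1 : ∀ x, ‖fderiv ℝ h x‖ ≤ 1)
    (x : EuclideanSpace ℝ (Fin d)) :
    |Pop μt h t x - ∫ y, h y ∂μX|
      ≤ Real.exp (-ε * t) * (2 * (‖x‖ ^ ε + ∫ z, ‖z‖ ^ ε ∂μX)) := by
  have hc := hd.continuous
  have hi : ∀ z, Integrable (fun y => h (z + y)) (μt t) := fun z =>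
    integrable_of_continuous_of_abs_le (by fun_prop) (fun y => h0 _)
  have : IsProbabilityMeasure (μX.map fun z => Real.exp (-t) • z) :=
    Measure.isProbabilityMeasure_map (by fun_prop)
  have hsm : StronglyMeasurable fun z => ∫ y, h (z + y) ∂μt t :=
    (hc.comp (continuous_fst.add continuous_snd)).stronglyMeasurable.integral_prod_right'
  have hb : ∀ z, |∫ y, h (z + y) ∂μt t| ≤ 1 := fun z => by
    simpa using norm_integral_le_of_norm_le_const (μ := μt t) (f := fun y => h (z + y)) (C := 1)
      (ae_of_all _ fun y => h0 _)
  have hE : ∫ y, h y ∂μX = ∫ z, Pop μt h t z ∂μX := by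
    have hic : Integrable h (μX.map (fun z => Real.exp (-t) • z) ∗ μt t) :=
      integrable_of_continuous_of_abs_le hc h0
    calc ∫ y, h y ∂μX = ∫ y, h y ∂(μX.map (fun z => Real.exp (-t) • z) ∗ μt t) := by rw [hself]
      _ = _ := by
        rw [integral_conv hic, integral_map (by fun_prop) hsm.aestronglyMeasurable]
        rfl
  have hPi : Integrable (Pop μt h t) μX :=
    (integrable_const (1 : ℝ)).mono'
      ((hsm.comp_measurable (measurable_const_smul (Real.exp (-t)))).aestronglyMeasurable)
      (ae_of_all _ fun z => hb _)
  have hpt : ∀ z, |Pop μt h t x - Pop μt h t z|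
      ≤ Real.exp (-ε * t) * (2 * (‖x‖ ^ ε + ‖z‖ ^ ε)) := by
    intro z
    unfold Pop
    rw [← integral_sub (hi _) (hi _)]
    suffices hs : ∀ y, ‖h (Real.exp (-t) • x + y) - h (Real.exp (-t) • z + y)‖
        ≤ Real.exp (-ε * t) * (2 * (‖x‖ ^ ε + ‖z‖ ^ ε)) by
      simpa using norm_integral_le_of_norm_le_const (μ := μt t) (ae_of_all _ hs)
    intro y
    refine (abs_sub_le_min_of_fderiv hd h0 h1 _ _).trans ?_
    rw [add_sub_add_right_eq_sub, ← smul_sub, norm_smul, Real.norm_eq_abs, Real.abs_exp]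
    refine (min_two_le_rpow (by positivity) hε).trans ?_
    rw [Real.mul_rpow (Real.exp_pos _).le (norm_nonneg _), ← Real.exp_mul,
      show -t * ε = -ε * t by ring]
    have h2 : ‖x - z‖ ^ ε ≤ ‖x‖ ^ ε + ‖z‖ ^ ε :=
      (Real.rpow_le_rpow (norm_nonneg _) (norm_sub_le _ _) hε.1.le).trans
        (Real.rpow_add_le_add_rpow (norm_nonneg _) (norm_nonneg _) hε.1.le hε.2.le)
    nlinarith [Real.exp_pos (-ε * t)]
  calc |Pop μt h t x - ∫ y, h y ∂μX|
      = |∫ z, (Pop μt h t x - Pop μt h t z) ∂μX| := by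
        rw [integral_sub (integrable_const _) hPi, hE]; simp
    _ ≤ ∫ z, Real.exp (-ε * t) * (2 * (‖x‖ ^ ε + ‖z‖ ^ ε)) ∂μX :=
        norm_integral_le_of_norm_le (f := fun z => Pop μt h t x - Pop μt h t z)
          (g := fun z => Real.exp (-ε * t) * (2 * (‖x‖ ^ ε + ‖z‖ ^ ε)))
          ((((integrable_const _).add hmom).const_mul _).const_mul _) (ae_of_all _ hpt)
    _ = _ := by
        rw [integral_const_mul, integral_const_mul, integral_add (integrable_const _) hmom]
        simp

variable (κ : Kernel ℝ (EuclideanSpace ℝ (Fin d))) [IsMarkovKernel κ]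

lemma integrableOn_Pop_sub_integral (hκ : ∀ t, 0 ≤ t → κ t = μt t)
    (hself : ∀ t, 0 ≤ t → μX.map (fun z => Real.exp (-t) • z) ∗ μt t = μX)
    (hε : ε ∈ Ioo (0 : ℝ) 1) (hmom : Integrable (fun z => ‖z‖ ^ ε) μX)
    (hd : ContDiff ℝ 1 h) (h0 : ∀ x, |h x| ≤ 1) (h1 : ∀ x, ‖fderiv ℝ h x‖ ≤ 1)
    (x : EuclideanSpace ℝ (Fin d)) :
    IntegrableOn (fun t => Pop μt h t x - ∫ y, h y ∂μX) (Ioi 0) := by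
  have hc := hd.continuous
  refine Integrable.mono' ((integrableOn_exp_neg_mul hε.1).mul_const
    (2 * (‖x‖ ^ ε + ∫ z, ‖z‖ ^ ε ∂μX))) ?_ ?_
  · have hm : StronglyMeasurable fun t => ∫ y, h (Real.exp (-t) • x + y) ∂κ t :=
      (Continuous.stronglyMeasurable
        (f := fun p : ℝ × EuclideanSpace ℝ (Fin d) => h (Real.exp (-p.1) • x + p.2))
        (by fun_prop)).integral_kernel_prod_right'
    refine AEStronglyMeasurable.sub ?_ aestronglyMeasurable_const
    refine hm.aestronglyMeasurable.congr ?_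
    filter_upwards [ae_restrict_mem measurableSet_Ioi] with t ht
    rw [hκ t (le_of_lt ht), Pop]
  · filter_upwards [ae_restrict_mem measurableSet_Ioi] with t ht
    have ht' : 0 ≤ t := le_of_lt ht
    have : IsProbabilityMeasure (μt t) := by rw [← hκ t ht']; infer_instance
    exact abs_Pop_sub_integral_le (hself t ht') hε hmom hd h0 h1 x

lemma integrable_timeLaw_increment (hd : ContDiff ℝ 1 h) (h0 : ∀ x, |h x| ≤ 1)
    (h1 : ∀ x, ‖fderiv ℝ h x‖ ≤ 1) (x : EuclideanSpace ℝ (Fin d)) :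
    Integrable (fun p : ℝ × EuclideanSpace ℝ (Fin d) =>
      h (Real.exp (-p.1) • x + p.2) - h p.2) (timeLaw κ) := by
  have hc := hd.continuous
  refine (integrable_timeLaw_comp_fst κ
    ((integrableOn_exp_neg_mul one_pos).mul_const ‖x‖)).mono'
    (Continuous.aestronglyMeasurable (by fun_prop)) (ae_of_all _ fun p => ?_)
  refine (abs_sub_le_min_of_fderiv hd h0 h1 _ _).trans ((min_le_right _ _).trans (le_of_eq ?_))
  rw [add_sub_cancel_right, norm_smul, Real.norm_eq_abs, Real.abs_exp, neg_one_mul]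

lemma steinSol_eq (hκ : ∀ t, 0 ≤ t → κ t = μt t)
    (hself : ∀ t, 0 ≤ t → μX.map (fun z => Real.exp (-t) • z) ∗ μt t = μX)
    (hε : ε ∈ Ioo (0 : ℝ) 1) (hmom : Integrable (fun z => ‖z‖ ^ ε) μX)
    (hd : ContDiff ℝ 1 h) (h0 : ∀ x, |h x| ≤ 1) (h1 : ∀ x, ‖fderiv ℝ h x‖ ≤ 1)
    (x : EuclideanSpace ℝ (Fin d)) :
    steinSol μX μt h x = steinSol μX μt h 0
      - ∫ p, (h (Real.exp (-p.1) • x + p.2) - h p.2) ∂timeLaw κ := by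
  have hI := integrableOn_Pop_sub_integral κ hκ hself hε hmom hd h0 h1
  have hc := hd.continuous
  unfold steinSol
  rw [Measure.integral_compProd (integrable_timeLaw_increment κ hd h0 h1 x), ← neg_add',
    add_comm, ← sub_eq_iff_eq_add.1 (?_ : _ - _ = _)]
  rw [← integral_sub (hI x) (hI 0)]
  refine setIntegral_congr_fun measurableSet_Ioi fun t ht => ?_
  have ht' : 0 ≤ t := le_of_lt ht
  have : IsProbabilityMeasure (μt t) := by rw [← hκ t ht']; infer_instance
  have hi : ∀ z, Integrable (fun y => h (z + y)) (μt t) := fun z =>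
    integrable_of_continuous_of_abs_le (by fun_prop) (fun y => h0 _)
  have hi0 := hi 0
  simp only [zero_add] at hi0
  simp only [Pop, hκ t ht', sub_sub_sub_cancel_right, smul_zero, zero_add]
  rw [integral_sub (hi _) hi0]

lemma hasFDerivAt_steinSol (hκ : ∀ t, 0 ≤ t → κ t = μt t)
    (hself : ∀ t, 0 ≤ t → μX.map (fun z => Real.exp (-t) • z) ∗ μt t = μX)
    (hε : ε ∈ Ioo (0 : ℝ) 1) (hmom : Integrable (fun z => ‖z‖ ^ ε) μX)
    (hd : ContDiff ℝ 1 h) (h0 : ∀ x, |h x| ≤ 1) (h1 : ∀ x, ‖fderiv ℝ h x‖ ≤ 1)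
    (x : EuclideanSpace ℝ (Fin d)) :
    HasFDerivAt (steinSol μX μt h)
      (-∫ p, Real.exp (-1 * p.1) • fderiv ℝ h (Real.exp (-p.1) • x + p.2) ∂timeLaw κ) x := by
  have h2 := hasFDerivAt_integral_exp_smul κ hd h1 (le_refl 0) (c := fun p => h p.2)
    (fun x => by simpa using integrable_timeLaw_increment κ hd h0 h1 x) x
  simp only [neg_zero, zero_mul, Real.exp_zero, one_smul, zero_add] at h2
  have h3 := h2.const_sub (steinSol μX μt h 0)
  exact h3.congr_of_eventuallyEq
    (Eventually.of_forall (steinSol_eq κ hκ hself hε hmom hd h0 h1))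

lemma contDiff_one_steinSol (hκ : ∀ t, 0 ≤ t → κ t = μt t)
    (hself : ∀ t, 0 ≤ t → μX.map (fun z => Real.exp (-t) • z) ∗ μt t = μX)
    (hε : ε ∈ Ioo (0 : ℝ) 1) (hmom : Integrable (fun z => ‖z‖ ^ ε) μX)
    (hd : ContDiff ℝ 1 h) (h0 : ∀ x, |h x| ≤ 1) (h1 : ∀ x, ‖fderiv ℝ h x‖ ≤ 1) :
    ContDiff ℝ 1 (steinSol μX μt h) ∧ ∀ x, ‖fderiv ℝ (steinSol μX μt h) x‖ ≤ 1 := by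
  have hD := hasFDerivAt_steinSol κ hκ hself hε hmom hd h0 h1
  refine ⟨contDiff_one_iff_hasFDerivAt.2 ⟨_, ?_, hD⟩, fun x => ?_⟩
  · exact (continuous_integral_exp_smul κ (hd.continuous_fderiv one_ne_zero) h1 one_pos).neg
  · rw [(hD x).fderiv, norm_neg]
    simpa using norm_integral_exp_smul_le κ h1 one_pos x

lemma contDiff_two_steinSol (hκ : ∀ t, 0 ≤ t → κ t = μt t)
    (hself : ∀ t, 0 ≤ t → μX.map (fun z => Real.exp (-t) • z) ∗ μt t = μX)
    (hε : ε ∈ Ioo (0 : ℝ) 1) (hmom : Integrable (fun z => ‖z‖ ^ ε) μX)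
    (hd : ContDiff ℝ 2 h) (h0 : ∀ x, |h x| ≤ 1) (h1 : ∀ x, ‖fderiv ℝ h x‖ ≤ 1)
    (h2 : ∀ x, ‖iteratedFDeriv ℝ 2 h x‖ ≤ 1) :
    ContDiff ℝ 2 (steinSol μX μt h)
      ∧ ∀ x, ‖iteratedFDeriv ℝ 2 (steinSol μX μt h) x‖ ≤ 1 / 2 := by
  have hd1 : ContDiff ℝ 1 h := hd.of_le one_le_two
  have hdd : ContDiff ℝ 1 (fderiv ℝ h) := hd.fderiv_right (by norm_num [one_add_one_eq_two])
  have h2' : ∀ x, ‖fderiv ℝ (fderiv ℝ h) x‖ ≤ 1 := fun x => by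
    rw [← norm_iteratedFDeriv_one, norm_iteratedFDeriv_fderiv]
    exact h2 x
  have hD := hasFDerivAt_steinSol κ hκ hself hε hmom hd1 h0 h1
  have hfd : fderiv ℝ (steinSol μX μt h) = _ := funext fun x => (hD x).fderiv
  have hD2 : ∀ x, HasFDerivAt (fderiv ℝ (steinSol μX μt h))
      (-∫ p, Real.exp (-2 * p.1) • fderiv ℝ (fderiv ℝ h) (Real.exp (-p.1) • x + p.2)
        ∂timeLaw κ) x := fun x => by
    rw [hfd]
    have := (hasFDerivAt_integral_exp_smul κ hdd h2' zero_le_one (c := 0)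
      (fun x => by simpa using
        integrable_exp_smul κ hdd.continuous h1 one_pos x) x).fun_neg
    simpa [one_add_one_eq_two] using this
  constructor
  · have hc1 : ContDiff ℝ 1 (fderiv ℝ (steinSol μX μt h)) :=
      contDiff_one_iff_hasFDerivAt.2 ⟨_,
        (continuous_integral_exp_smul κ (hdd.continuous_fderiv one_ne_zero) h2' two_pos).neg, hD2⟩
    rw [show (2 : WithTop ℕ∞) = 1 + 1 from one_add_one_eq_two.symm, contDiff_succ_iff_fderiv]
    exact ⟨fun x => (hD x).differentiableAt, by simp, hc1⟩
  · intro x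
    rw [← norm_iteratedFDeriv_fderiv, norm_iteratedFDeriv_one, (hD2 x).fderiv, norm_neg]
    exact norm_integral_exp_smul_le κ h2' two_pos x

end Regularity

section Polar

lemma tail_measure_eq {m : Measure ℝ} {f : ℝ → ℝ}
    (hm : ∀ a c : ℝ, 0 < a → a ≤ c → m (Ioc a c) = ENNReal.ofReal (f a - f c))
    (hf : Tendsto f atTop (𝓝 0)) {a : ℝ} (ha : 0 < a) :
    m (Ioi a) = ENNReal.ofReal (f a) := by
  have hU : Ioi a = ⋃ n : ℕ, Ioc a (a + n) := by
    ext r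
    simp only [mem_Ioi, mem_iUnion, mem_Ioc, exists_and_left]
    refine ⟨fun h => ⟨h, ?_⟩, fun h => h.1⟩
    obtain ⟨n, hn⟩ := exists_nat_ge (r - a)
    exact ⟨n, by linarith⟩
  have hmono : Monotone fun n : ℕ => Ioc a (a + n) := fun i j hij =>
    Ioc_subset_Ioc_right (by gcongr)
  have h1 := tendsto_measure_iUnion_atTop (μ := m) hmono
  rw [← hU] at h1
  have h2 : Tendsto (fun n : ℕ => ENNReal.ofReal (f a - f (a + n))) atTop
      (𝓝 (ENNReal.ofReal (f a - 0))) :=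
    ENNReal.tendsto_ofReal (tendsto_const_nhds.sub
      (hf.comp (tendsto_atTop_add_const_left _ a tendsto_natCast_atTop_atTop)))
  rw [sub_zero] at h2
  refine tendsto_nhds_unique h1 (h2.congr fun n => ?_)
  exact (hm a _ ha (by simp)).symm

lemma sigmaFinite_of_tail {m : Measure ℝ} (h0 : m (Iic 0) = 0)
    (hm : ∀ a : ℝ, 0 < a → m (Ioi a) < ∞) : SigmaFinite m := by
  refine ⟨⟨{ set := fun n : ℕ => Iic 0 ∪ Ioi (1 / ((n : ℝ) + 1))
             set_mem := fun _ => trivial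
             finite := fun n => ?_
             spanning := ?_ }⟩⟩
  · refine (measure_union_le _ _).trans_lt ?_
    rw [h0, zero_add]
    exact hm _ (by positivity)
  · rw [eq_univ_iff_forall]
    intro r
    rcases le_or_gt r 0 with h | h
    · exact mem_iUnion.2 ⟨0, Or.inl h⟩
    · obtain ⟨n, hn⟩ := exists_nat_one_div_lt h
      exact mem_iUnion.2 ⟨n, Or.inr hn⟩

lemma lintegral_exp_neg_mul {G : ℝ → ℝ≥0∞} {r : ℝ} (hr : 0 < r) :
    ∫⁻ s in Ioi (0 : ℝ), G (Real.exp (-s) * r)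
      = ∫⁻ ρ in Ioo 0 r, ENNReal.ofReal ρ⁻¹ * G ρ := by
  have him : (fun s : ℝ => Real.exp (-s) * r) '' Ioi 0 = Ioo 0 r := by
    ext ρ
    simp only [mem_image, mem_Ioi, mem_Ioo]
    constructor
    · rintro ⟨s, hs, rfl⟩
      have h1 : Real.exp (-s) < 1 := by simpa using hs
      exact ⟨by positivity, by nlinarith⟩
    · rintro ⟨h0, h1⟩
      refine ⟨-Real.log (ρ / r), ?_, ?_⟩
      · have := Real.log_neg (div_pos h0 hr) ((div_lt_one hr).2 h1)
        linarith
      · rw [neg_neg, Real.exp_log (div_pos h0 hr)]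
        field_simp
  have hd : ∀ s ∈ Ioi (0 : ℝ), HasDerivWithinAt (fun s : ℝ => Real.exp (-s) * r)
      (-Real.exp (-s) * r) (Ioi 0) s := fun s _ => by
    have h1 := ((hasDerivAt_neg s).exp.mul_const r).hasDerivWithinAt (s := Ioi 0)
    simpa using h1
  have hinj : InjOn (fun s : ℝ => Real.exp (-s) * r) (Ioi 0) := by
    intro s _ t _ hst
    have h1 := mul_right_cancel₀ hr.ne' hst
    linarith [Real.exp_injective h1]
  rw [← him, lintegral_image_eq_lintegral_abs_deriv_mul measurableSet_Ioi hd hinj]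
  refine setLIntegral_congr_fun measurableSet_Ioi fun s _ => ?_
  have hp : 0 < Real.exp (-s) * r := by positivity
  simp only [neg_mul, abs_neg, abs_of_pos hp]
  rw [← mul_assoc, ← ENNReal.ofReal_mul hp.le, mul_inv_cancel₀ hp.ne', ENNReal.ofReal_one, one_mul]

/-- The one-dimensional form of the relation between the Lévy measure of a self-decomposable
law and the measure generated by the decreasing function `f`. -/
lemma lintegral_lintegral_exp_neg_mul {m : Measure ℝ} {f : ℝ → ℝ} (h0 : m (Iic 0) = 0)
    (hm : ∀ a : ℝ, 0 < a → m (Ioi a) = ENNReal.ofReal (f a))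
    {G : ℝ → ℝ≥0∞} (hG : Measurable G) :
    ∫⁻ r, (∫⁻ s in Ioi (0 : ℝ), G (Real.exp (-s) * r)) ∂m
      = ∫⁻ ρ in Ioi (0 : ℝ), G ρ * ENNReal.ofReal (f ρ / ρ) := by
  have hsf : SigmaFinite m :=
    sigmaFinite_of_tail h0 fun a ha => by rw [hm a ha]; exact ENNReal.ofReal_lt_top
  have hpos : ∀ᵐ r ∂m, 0 < r := by
    rw [ae_iff]
    simpa [Iic] using h0
  have hset : MeasurableSet {p : ℝ × ℝ | p.2 < p.1} := measurableSet_lt measurable_snd measurable_fst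
  calc ∫⁻ r, (∫⁻ s in Ioi (0 : ℝ), G (Real.exp (-s) * r)) ∂m
      = ∫⁻ r, (∫⁻ ρ in Ioi (0 : ℝ), {p : ℝ × ℝ | p.2 < p.1}.indicator
          (fun p => ENNReal.ofReal p.2⁻¹ * G p.2) (r, ρ)) ∂m := by
        refine lintegral_congr_ae (hpos.mono fun r hr => ?_)
        simp only
        rw [lintegral_exp_neg_mul hr, ← Ioi_inter_Iio, inter_comm,
          ← Measure.restrict_restrict measurableSet_Iio, ← lintegral_indicator measurableSet_Iio]
        rfl
    _ = ∫⁻ ρ in Ioi (0 : ℝ), ∫⁻ r, {p : ℝ × ℝ | p.2 < p.1}.indicator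
          (fun p => ENNReal.ofReal p.2⁻¹ * G p.2) (r, ρ) ∂m := by
        refine lintegral_lintegral_swap (Measurable.aemeasurable ?_)
        exact Measurable.indicator (by fun_prop) hset
    _ = _ := by
        refine setLIntegral_congr_fun measurableSet_Ioi fun ρ hρ => ?_
        have h1 : ∀ r, {p : ℝ × ℝ | p.2 < p.1}.indicator
            (fun p => ENNReal.ofReal p.2⁻¹ * G p.2) (r, ρ)
            = (Ioi ρ).indicator (fun _ => ENNReal.ofReal ρ⁻¹ * G ρ) r := fun r => rfl
        have hρ' : 0 < ρ := hρ
        simp only [h1]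
        rw [lintegral_indicator_const measurableSet_Ioi, hm ρ hρ, div_eq_inv_mul,
          ENNReal.ofReal_mul (by positivity)]
        ring

variable {E : Type*} [NormedAddCommGroup E] [InnerProductSpace ℝ E] [FiniteDimensional ℝ E]
  [MeasurableSpace E] [BorelSpace E]
  {ν νt σ : Measure E} {k : E → ℝ → ℝ} {τ : E → Measure ℝ}

lemma ae_norm_eq_one (hσ : σ {x : E | ¬ ‖x‖ = 1} = 0) : ∀ᵐ x ∂σ, ‖x‖ = 1 := hσ

lemma aemeasurable_of_continuousOn_sphere (hσ : σ {x : E | ¬ ‖x‖ = 1} = 0) {f : E → ℝ}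
    (hf : ContinuousOn f {x : E | ‖x‖ = 1}) : AEMeasurable f σ := by
  have hcl : IsClosed {x : E | ‖x‖ = 1} := isClosed_eq continuous_norm continuous_const
  have h : σ.restrict {x : E | ‖x‖ = 1} = σ :=
    Measure.restrict_eq_self_of_ae_mem (ae_norm_eq_one hσ)
  exact h ▸ hf.aemeasurable hcl.measurableSet

lemma exists_bound_on_sphere {f : E → ℝ} (hf : ContinuousOn f {x : E | ‖x‖ = 1}) :
    ∃ C : ℝ, ∀ x, ‖x‖ = 1 → |f x| ≤ C := by
  have hc : IsCompact {x : E | ‖x‖ = 1} := by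
    have h : {x : E | ‖x‖ = 1} = Metric.sphere 0 1 := by ext; simp
    rw [h]
    exact isCompact_sphere 0 1
  obtain ⟨C, hC⟩ := hc.exists_bound_of_continuousOn hf
  exact ⟨C, fun x hx => hC x hx⟩

lemma lintegral_annulus (hσ : σ {x : E | ¬ ‖x‖ = 1} = 0)
    (hτ0 : ∀ x, τ x (Iic 0) = 0)
    (hτ : ∀ x, ‖x‖ = 1 → ∀ a, 0 < a → τ x (Ioi a) = ENNReal.ofReal (k x a))
    (hνt : ∀ g : E → ℝ≥0∞, Measurable g → ∫⁻ u, g u ∂νt = ∫⁻ x, (∫⁻ r, g (r • x) ∂(τ x)) ∂σ)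
    {a : ℝ} (ha : 0 < a) {g : E → ℝ≥0∞} (hg : Measurable g) :
    ∫⁻ u in {u | a < ‖u‖}, g (‖u‖⁻¹ • u) ∂νt = ∫⁻ x, g x * ENNReal.ofReal (k x a) ∂σ := by
  have hset : MeasurableSet {u : E | a < ‖u‖} := measurableSet_lt measurable_const measurable_norm
  have hgm : Measurable fun u : E => g (‖u‖⁻¹ • u) := hg.comp (by fun_prop)
  rw [← lintegral_indicator hset, hνt _ (hgm.indicator hset)]
  refine lintegral_congr_ae ((ae_norm_eq_one hσ).mono fun x hx => ?_)
  simp only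
  rw [← hτ x hx a ha, ← lintegral_indicator_const measurableSet_Ioi]
  have hpos : ∀ᵐ r ∂(τ x), 0 < r := by
    rw [ae_iff]
    simpa [Iic] using hτ0 x
  refine lintegral_congr_ae (hpos.mono fun r hr => ?_)
  have hn : ‖r • x‖ = r := by rw [norm_smul, hx, mul_one, Real.norm_of_nonneg hr.le]
  simp only
  by_cases h : a < r
  · rw [indicator_of_mem (by simpa [hn] using h), indicator_of_mem (by simpa using h), hn, smul_smul,
      inv_mul_cancel₀ hr.ne', one_smul]
  · rw [indicator_of_notMem (by simpa [hn] using h), indicator_of_notMem (by simpa using h)]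

lemma measure_norm_gt_lt_top [IsFiniteMeasure σ] (hσ : σ {x : E | ¬ ‖x‖ = 1} = 0)
    (hkcx : ∀ r : ℝ, 0 < r → ContinuousOn (fun x => k x r) {x : E | ‖x‖ = 1})
    (hτ0 : ∀ x, τ x (Iic 0) = 0)
    (hτ : ∀ x, ‖x‖ = 1 → ∀ a, 0 < a → τ x (Ioi a) = ENNReal.ofReal (k x a))
    (hνt : ∀ g : E → ℝ≥0∞, Measurable g → ∫⁻ u, g u ∂νt = ∫⁻ x, (∫⁻ r, g (r • x) ∂(τ x)) ∂σ)
    {a : ℝ} (ha : 0 < a) : νt {u | a < ‖u‖} < ∞ := by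
  obtain ⟨C, hC⟩ := exists_bound_on_sphere (hkcx a ha)
  have h := lintegral_annulus hσ hτ0 hτ hνt ha (g := fun _ => 1) measurable_const
  rw [setLIntegral_one] at h
  rw [h]
  calc ∫⁻ x, 1 * ENNReal.ofReal (k x a) ∂σ ≤ ∫⁻ _, ENNReal.ofReal C ∂σ := by
        refine lintegral_mono_ae ((ae_norm_eq_one hσ).mono fun x hx => ?_)
        rw [one_mul]
        exact ENNReal.ofReal_le_ofReal ((le_abs_self _).trans (hC x hx))
    _ < ∞ := by
        rw [lintegral_const]
        exact ENNReal.mul_lt_top ENNReal.ofReal_lt_top (measure_lt_top _ _)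

lemma sigmaFinite_of_measure_norm_gt_lt_top (h0 : νt {0} = 0)
    (h : ∀ a : ℝ, 0 < a → νt {u | a < ‖u‖} < ∞) : SigmaFinite νt := by
  refine ⟨⟨{ set := fun n : ℕ => {0} ∪ {u | 1 / ((n : ℝ) + 1) < ‖u‖}
             set_mem := fun _ => trivial
             finite := fun n => ?_
             spanning := ?_ }⟩⟩
  · refine (measure_union_le _ _).trans_lt ?_
    rw [h0, zero_add]
    exact h _ (by positivity)
  · rw [eq_univ_iff_forall]
    intro u
    rcases eq_or_ne u 0 with hu | hu
    · exact mem_iUnion.2 ⟨0, Or.inl hu⟩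
    · obtain ⟨n, hn⟩ := exists_nat_one_div_lt (norm_pos_iff.2 hu)
      exact mem_iUnion.2 ⟨n, Or.inr hn⟩

lemma measure_singleton_zero (hσ : σ {x : E | ¬ ‖x‖ = 1} = 0)
    (hτ0 : ∀ x, τ x (Iic 0) = 0)
    (hνt : ∀ g : E → ℝ≥0∞, Measurable g → ∫⁻ u, g u ∂νt = ∫⁻ x, (∫⁻ r, g (r • x) ∂(τ x)) ∂σ) :
    νt {0} = 0 := by
  rw [← lintegral_indicator_one (measurableSet_singleton _),
    hνt _ (measurable_one.indicator (measurableSet_singleton _))]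
  rw [← lintegral_zero (μ := σ)]
  refine lintegral_congr_ae ((ae_norm_eq_one hσ).mono fun x hx => ?_)
  simp only
  have hpos : ∀ᵐ r ∂(τ x), 0 < r := by
    rw [ae_iff]
    simpa [Iic] using hτ0 x
  rw [← lintegral_zero (μ := τ x)]
  refine lintegral_congr_ae (hpos.mono fun r hr => ?_)
  have hx0 : x ≠ 0 := by rintro rfl; simp at hx
  simp [hr.ne', hx0]

/-- The Lévy measure of a self-decomposable law is the image of `dt ⊗ ν̃` under
`(t, u) ↦ e^{-t} u`. -/
lemma levyMeasure_eq_map [SFinite νt] (hσ : σ {x : E | ¬ ‖x‖ = 1} = 0)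
    (hpolar : ∀ g : E → ℝ≥0∞, Measurable g → ∫⁻ u, g u ∂ν
      = ∫⁻ x, (∫⁻ r in Ioi (0 : ℝ), g (r • x) * ENNReal.ofReal (k x r / r)) ∂σ)
    (hτ0 : ∀ x, τ x (Iic 0) = 0)
    (hτ : ∀ x, ‖x‖ = 1 → ∀ a, 0 < a → τ x (Ioi a) = ENNReal.ofReal (k x a))
    (hνt : ∀ g : E → ℝ≥0∞, Measurable g → ∫⁻ u, g u ∂νt = ∫⁻ x, (∫⁻ r, g (r • x) ∂(τ x)) ∂σ) :
    ν = ((volume.restrict (Ioi (0 : ℝ))).prod νt).map (fun p => Real.exp (-p.1) • p.2) := by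
  have hmeas : Measurable fun p : ℝ × E => Real.exp (-p.1) • p.2 := by fun_prop
  ext s hs
  have hg : Measurable (s.indicator (1 : E → ℝ≥0∞)) := measurable_one.indicator hs
  have hgm : Measurable fun p : ℝ × E => s.indicator (1 : E → ℝ≥0∞) (Real.exp (-p.1) • p.2) :=
    hg.comp hmeas
  rw [← lintegral_indicator_one hs, ← lintegral_indicator_one hs, lintegral_map hg hmeas,
    lintegral_prod_symm _ hgm.aemeasurable, hpolar _ hg]
  simp only
  rw [hνt _ hgm.lintegral_prod_left']
  refine lintegral_congr_ae ((ae_norm_eq_one hσ).mono fun x hx => ?_)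
  have hG : Measurable fun ρ : ℝ => s.indicator (1 : E → ℝ≥0∞) (ρ • x) := hg.comp (by fun_prop)
  have h1 := lintegral_lintegral_exp_neg_mul (hτ0 x) (hτ x hx) hG
  simp only [smul_smul]
  exact h1.symm

lemma lintegral_min_one_norm_sq_lt_top (hσ : σ {x : E | ¬ ‖x‖ = 1} = 0)
    (hpolar : ∀ g : E → ℝ≥0∞, Measurable g → ∫⁻ u, g u ∂ν
      = ∫⁻ x, (∫⁻ r in Ioi (0 : ℝ), g (r • x) * ENNReal.ofReal (k x r / r)) ∂σ)
    (h1 : ∫⁻ x, (∫⁻ r in Ioi (1 : ℝ), ENNReal.ofReal (k x r / r)) ∂σ < ∞)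
    (h2 : ∫⁻ x, (∫⁻ r in Ioo (0 : ℝ) 1, ENNReal.ofReal (r * k x r)) ∂σ < ∞) :
    ∫⁻ u, ENNReal.ofReal (min 1 (‖u‖ ^ 2)) ∂ν < ∞ := by
  have hset : MeasurableSet {u : E | ‖u‖ < 1} := measurableSet_lt measurable_norm measurable_const
  have hgm : Measurable fun u : E => ENNReal.ofReal (min 1 (‖u‖ ^ 2)) := by fun_prop
  rw [← lintegral_add_compl _ hset, ENNReal.add_lt_top]
  constructor
  · rw [← lintegral_indicator hset, hpolar _ (hgm.indicator hset)]
    refine lt_of_eq_of_lt (lintegral_congr_ae ((ae_norm_eq_one hσ).mono fun x hx => ?_)) h2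
    simp only
    rw [← Iio_inter_Ioi, ← Measure.restrict_restrict measurableSet_Iio,
      ← lintegral_indicator measurableSet_Iio]
    refine setLIntegral_congr_fun measurableSet_Ioi fun r hr => ?_
    have hr' : 0 < r := hr
    have hn : ‖r • x‖ = r := by rw [norm_smul, hx, mul_one, Real.norm_of_nonneg hr'.le]
    by_cases h : r < 1
    · rw [indicator_of_mem (by simpa [hn] using h), indicator_of_mem (by simpa using h), hn,
        min_eq_right (by nlinarith), ← ENNReal.ofReal_mul (by positivity)]
      congr 1
      field_simp
    · rw [indicator_of_notMem (by simpa [hn] using h), indicator_of_notMem (by simpa using h),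
        zero_mul]
  · rw [← lintegral_indicator hset.compl, hpolar _ (hgm.indicator hset.compl)]
    refine lt_of_eq_of_lt (lintegral_congr_ae ((ae_norm_eq_one hσ).mono fun x hx => ?_)) h1
    simp only
    rw [← Measure.restrict_congr_set (Ioi_ae_eq_Ici (a := (1 : ℝ))).symm,
      ← inter_eq_left.2 (Ici_subset_Ioi.2 (zero_lt_one (α := ℝ))),
      ← Measure.restrict_restrict measurableSet_Ici,
      ← lintegral_indicator measurableSet_Ici]
    refine setLIntegral_congr_fun measurableSet_Ioi fun r hr => ?_
    have hr' : 0 < r := hr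
    have hn : ‖r • x‖ = r := by rw [norm_smul, hx, mul_one, Real.norm_of_nonneg hr'.le]
    by_cases h : r < 1
    · rw [indicator_of_notMem (by simpa [hn] using h), indicator_of_notMem (by simpa using h),
        zero_mul]
    · rw [indicator_of_mem (by simpa [hn] using h), indicator_of_mem (by simpa using h), hn,
        min_eq_left (by nlinarith), ENNReal.ofReal_one, one_mul]

lemma integral_annulus_eq [IsFiniteMeasure σ] (hσ : σ {x : E | ¬ ‖x‖ = 1} = 0)
    (hk0 : ∀ x, ∀ r : ℝ, 0 < r → 0 ≤ k x r)
    (hkcx : ∀ r : ℝ, 0 < r → ContinuousOn (fun x => k x r) {x : E | ‖x‖ = 1})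
    (hτ0 : ∀ x, τ x (Iic 0) = 0)
    (hτ : ∀ x, ‖x‖ = 1 → ∀ a, 0 < a → τ x (Ioi a) = ENNReal.ofReal (k x a))
    (hνt : ∀ g : E → ℝ≥0∞, Measurable g → ∫⁻ u, g u ∂νt = ∫⁻ x, (∫⁻ r, g (r • x) ∂(τ x)) ∂σ) :
    ∫ u in {u | 1 < ‖u‖}, ‖u‖⁻¹ • u ∂νt = ∫ y, k y 1 • y ∂σ := by
  have hkm := (aemeasurable_of_continuousOn_sphere hσ (hkcx 1 one_pos)).ennreal_ofReal
  have hmeas : Measurable fun u : E => ‖u‖⁻¹ • u := by fun_prop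
  have hmap : (νt.restrict {u | 1 < ‖u‖}).map (fun u => ‖u‖⁻¹ • u)
      = σ.withDensity fun y => ENNReal.ofReal (k y 1) := by
    ext s hs
    have h := lintegral_annulus hσ hτ0 hτ hνt one_pos (measurable_one.indicator hs)
    rw [withDensity_apply _ hs, ← lintegral_indicator hs, ← lintegral_indicator_one hs,
      lintegral_map (measurable_one.indicator hs) hmeas, h]
    refine lintegral_congr fun x => ?_
    by_cases hx : x ∈ s <;> simp [hx]
  have h1 : ∫ u in {u | 1 < ‖u‖}, ‖u‖⁻¹ • u ∂νt
      = ∫ y, y ∂(νt.restrict {u | 1 < ‖u‖}).map (fun u => ‖u‖⁻¹ • u) :=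
    (integral_map hmeas.aemeasurable aestronglyMeasurable_id).symm
  rw [h1, hmap, integral_withDensity_eq_integral_toReal_smul₀ hkm
    (ae_of_all _ fun _ => ENNReal.ofReal_lt_top)]
  refine integral_congr_ae (ae_of_all _ fun y => ?_)
  simp only
  rw [ENNReal.toReal_ofReal (hk0 _ _ one_pos)]

end Polar

section Exponent

lemma norm_exp_I_mul_sub_one_sub_le (θ : ℝ) :
    ‖Complex.exp (Complex.I * θ) - 1 - Complex.I * θ‖ ≤ 3 * θ ^ 2 := by
  have hn : ‖Complex.I * (θ : ℂ)‖ = |θ| := by simp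
  rcases le_total |θ| 1 with h | h
  · have h1 := Complex.norm_exp_sub_one_sub_id_le (hn.trans_le h)
    rw [hn, sq_abs] at h1
    nlinarith [sq_nonneg θ]
  · have h1 : ‖Complex.exp (Complex.I * θ) - 1‖ ≤ |θ| := Real.norm_exp_I_mul_ofReal_sub_one_le
    have h2 := norm_sub_le (Complex.exp (Complex.I * θ) - 1) (Complex.I * θ)
    rw [hn] at h2
    nlinarith [sq_abs θ]

lemma norm_exp_I_mul_sub_one_le_two (θ : ℝ) : ‖Complex.exp (Complex.I * θ) - 1‖ ≤ 2 := by
  have h1 := norm_sub_le (Complex.exp (Complex.I * θ)) 1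
  rw [mul_comm, Complex.norm_exp_ofReal_mul_I, norm_one] at h1
  rw [mul_comm]
  linarith

lemma integral_ite_exp_neg {r : ℝ} (hr : 1 < r) :
    ∫ t in Ioi (0 : ℝ), (if Real.exp (-t) * r ≤ 1 then Real.exp (-t) else 0) = r⁻¹ := by
  have hr0 : 0 < r := by linarith
  have hiff : ∀ t, Real.exp (-t) * r ≤ 1 ↔ t ∈ Ici (Real.log r) := fun t => by
    rw [mem_Ici, Real.log_le_iff_le_exp hr0, Real.exp_neg, inv_mul_le_iff₀ (Real.exp_pos _), mul_one]
  have h1 : (fun t : ℝ => if Real.exp (-t) * r ≤ 1 then Real.exp (-t) else 0)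
      = (Ici (Real.log r)).indicator fun t => Real.exp (-t) := by
    ext t
    by_cases h : Real.exp (-t) * r ≤ 1
    · rw [if_pos h, indicator_of_mem ((hiff t).1 h)]
    · rw [if_neg h, indicator_of_notMem (mt (hiff t).2 h)]
  rw [h1, setIntegral_indicator measurableSet_Ici,
    inter_eq_right.2 (Ici_subset_Ioi.2 (Real.log_pos hr)), integral_Ici_eq_integral_Ioi,
    integral_exp_neg_Ioi, Real.exp_neg, Real.exp_log hr0]

variable {E : Type*} [NormedAddCommGroup E] [InnerProductSpace ℝ E]

/-- The integrand of the Lévy–Khintchine exponent. -/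
def levyKernel (ζ u : E) : ℂ :=
  Complex.exp (Complex.I * ((⟪ζ, u⟫ : ℝ) : ℂ)) - 1
    - (if ‖u‖ ≤ 1 then Complex.I * ((⟪ζ, u⟫ : ℝ) : ℂ) else 0)

/-- The weight comparing the truncations before and after scaling by `e^{-t}`. -/
def truncWeight (t : ℝ) (u : E) : ℝ :=
  if 1 < ‖u‖ then (if Real.exp (-t) * ‖u‖ ≤ 1 then Real.exp (-t) else 0) else 0

/-- A dominating function for the Lévy–Khintchine integrand at `e^{-t} ζ`. -/
def levyDom (t : ℝ) (u : E) : ℝ :=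
  min 1 (‖Real.exp (-t) • u‖ ^ 2) + truncWeight t u * ‖u‖

lemma truncWeight_nonneg (t : ℝ) (u : E) : 0 ≤ truncWeight t u := by
  unfold truncWeight
  split_ifs <;> positivity

lemma integral_truncWeight (u : E) :
    ∫ t in Ioi (0 : ℝ), truncWeight t u = {u : E | 1 < ‖u‖}.indicator (fun u => ‖u‖⁻¹) u := by
  by_cases h : 1 < ‖u‖
  · simp only [truncWeight, if_pos h]
    rw [integral_ite_exp_neg h, indicator_of_mem (by exact h)]
  · simp [truncWeight, h]

lemma levyDom_zero (u : E) : levyDom 0 u = min 1 (‖u‖ ^ 2) := by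
  have h : truncWeight 0 u = 0 := by
    unfold truncWeight
    split_ifs with h1 h2
    · rw [neg_zero, Real.exp_zero, one_mul] at h2
      linarith
    · rfl
    · rfl
  rw [levyDom, h]
  simp

lemma levyKernel_smul_right (ζ u : E) {s : ℝ} (hs : 0 ≤ s) :
    levyKernel ζ (Real.exp (-s) • u) = levyKernel (Real.exp (-s) • ζ) u
      - Complex.I * ((truncWeight s u * ⟪ζ, u⟫ : ℝ) : ℂ) := by
  have ha : Real.exp (-s) ≤ 1 := by simpa using hs
  have ha0 := Real.exp_pos (-s)
  have hn : ‖Real.exp (-s) • u‖ = Real.exp (-s) * ‖u‖ := by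
    rw [norm_smul, Real.norm_eq_abs, Real.abs_exp]
  simp only [levyKernel, truncWeight, real_inner_smul_left, real_inner_smul_right, hn]
  rcases le_or_gt ‖u‖ 1 with h | h
  · have h2 : Real.exp (-s) * ‖u‖ ≤ 1 := by nlinarith [norm_nonneg u]
    simp [h, h2, not_lt.2 h]
  · by_cases h2 : Real.exp (-s) * ‖u‖ ≤ 1
    · simp [h, h2, not_le.2 h]
    · simp [h2, not_le.2 h]

lemma norm_levyKernel_exp_smul_le (ζ u : E) {t : ℝ} (ht : 0 ≤ t) :
    ‖levyKernel (Real.exp (-t) • ζ) u‖ ≤ 3 * (1 + ‖ζ‖ ^ 2) * levyDom t u := by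
  have ha : Real.exp (-t) ≤ 1 := by simpa using ht
  have ha0 := Real.exp_pos (-t)
  have hn : ‖Real.exp (-t) • u‖ = Real.exp (-t) * ‖u‖ := by
    rw [norm_smul, Real.norm_eq_abs, Real.abs_exp]
  have hin : |⟪Real.exp (-t) • ζ, u⟫| ≤ ‖ζ‖ * (Real.exp (-t) * ‖u‖) := by
    rw [real_inner_smul_left, abs_mul, Real.abs_exp]
    nlinarith [abs_real_inner_le_norm ζ u]
  have hζ := norm_nonneg ζ
  have hu := norm_nonneg u
  unfold levyDom levyKernel
  rw [hn]
  set a := Real.exp (-t)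
  rcases le_or_gt ‖u‖ 1 with h | h
  · have h1 : a * ‖u‖ ≤ 1 := by nlinarith
    have h2 := norm_exp_I_mul_sub_one_sub_le ⟪a • ζ, u⟫
    have h3 : ⟪a • ζ, u⟫ ^ 2 ≤ (‖ζ‖ * (a * ‖u‖)) ^ 2 := by
      rw [← sq_abs]
      gcongr
    have h4 : 0 ≤ truncWeight t u * ‖u‖ := mul_nonneg (truncWeight_nonneg t u) hu
    rw [if_pos h, min_eq_right (by nlinarith [mul_nonneg ha0.le hu])]
    refine h2.trans ?_
    nlinarith [sq_nonneg (a * ‖u‖), mul_nonneg (sq_nonneg ‖ζ‖) h4]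
  · rw [if_neg (not_le.2 h), sub_zero, truncWeight, if_pos h]
    by_cases h2 : a * ‖u‖ ≤ 1
    · rw [if_pos h2]
      have h3 : ‖Complex.exp (Complex.I * (⟪a • ζ, u⟫ : ℝ)) - 1‖ ≤ |⟪a • ζ, u⟫| :=
        Real.norm_exp_I_mul_ofReal_sub_one_le
      have h4 : 0 ≤ min 1 ((a * ‖u‖) ^ 2) := by positivity
      have h5 : 0 ≤ a * ‖u‖ := by positivity
      have h6 : ‖ζ‖ ≤ 1 + ‖ζ‖ ^ 2 := by nlinarith
      calc _ ≤ ‖ζ‖ * (a * ‖u‖) := h3.trans hin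
        _ ≤ (1 + ‖ζ‖ ^ 2) * (a * ‖u‖) := by gcongr
        _ ≤ 3 * (1 + ‖ζ‖ ^ 2) * (min 1 ((a * ‖u‖) ^ 2) + a * ‖u‖) := by
          have : 0 ≤ (1 + ‖ζ‖ ^ 2) * min 1 ((a * ‖u‖) ^ 2) := by positivity
          nlinarith [mul_nonneg (by positivity : 0 ≤ 1 + ‖ζ‖ ^ 2) h5]
    · have h3 := norm_exp_I_mul_sub_one_le_two ⟪a • ζ, u⟫
      rw [if_neg h2, min_eq_left (by nlinarith)]
      nlinarith [sq_nonneg ‖ζ‖]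

variable [FiniteDimensional ℝ E] [MeasurableSpace E] [BorelSpace E]

lemma measurable_levyKernel : Measurable fun p : E × E => levyKernel p.1 p.2 := by
  unfold levyKernel
  refine Measurable.sub (by fun_prop) (Measurable.ite ?_ (by fun_prop) measurable_const)
  exact measurableSet_le (by fun_prop) measurable_const

lemma measurable_levyKernel_right (ζ : E) : Measurable (levyKernel ζ) :=
  Measurable.of_uncurry_left (f := levyKernel) measurable_levyKernel

lemma measurable_truncWeight : Measurable fun p : ℝ × E => truncWeight p.1 p.2 := by
  unfold truncWeight
  refine Measurable.ite (measurableSet_lt measurable_const (by fun_prop))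
    (Measurable.ite ?_ (by fun_prop) measurable_const) measurable_const
  exact measurableSet_le (by fun_prop) measurable_const

variable {ν N : Measure E} [SFinite N]

lemma integrable_truncWeight_mul_norm (hN : N {u | 1 < ‖u‖} < ∞) :
    Integrable (fun p : ℝ × E => truncWeight p.1 p.2 * ‖p.2‖)
      ((volume.restrict (Ioi (0 : ℝ))).prod N) := by
  have hm : Measurable fun p : ℝ × E => truncWeight p.1 p.2 * ‖p.2‖ := by
    have := measurable_truncWeight (E := E)
    fun_prop
  have hset : MeasurableSet {u : E | 1 < ‖u‖} := measurableSet_lt measurable_const measurable_norm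
  rw [integrable_prod_iff' hm.aestronglyMeasurable]
  refine ⟨ae_of_all _ fun u => ?_, ?_⟩
  · refine ((integrableOn_exp_neg_Ioi 0).mul_const ‖u‖).mono'
      (hm.comp (by fun_prop : Measurable fun t : ℝ => (t, u))).aestronglyMeasurable
      (ae_of_all _ fun t => ?_)
    simp only
    rw [Real.norm_of_nonneg (mul_nonneg (truncWeight_nonneg _ _) (norm_nonneg _))]
    refine mul_le_mul_of_nonneg_right ?_ (norm_nonneg _)
    unfold truncWeight
    split_ifs
    · exact le_rfl
    · positivity
    · positivity
  · have h1 : ∀ u : E, ∫ t in Ioi (0 : ℝ), ‖truncWeight t u * ‖u‖‖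
        = {u : E | 1 < ‖u‖}.indicator (fun _ => (1 : ℝ)) u := fun u => by
      simp only [Real.norm_of_nonneg (mul_nonneg (truncWeight_nonneg _ u) (norm_nonneg u))]
      rw [integral_mul_const, integral_truncWeight]
      by_cases h : u ∈ {u : E | 1 < ‖u‖}
      · rw [indicator_of_mem h, indicator_of_mem h]
        have : (0 : ℝ) < ‖u‖ := zero_lt_one.trans h
        exact inv_mul_cancel₀ this.ne'
      · rw [indicator_of_notMem h, indicator_of_notMem h, zero_mul]
    simp only [h1]
    exact (integrable_indicator_iff hset).2 (integrableOn_const hN.ne)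

variable (hν : ν = ((volume.restrict (Ioi (0 : ℝ))).prod N).map
    (fun p => Real.exp (-p.1) • p.2))
  (hJ : ∫⁻ u, ENNReal.ofReal (min 1 (‖u‖ ^ 2)) ∂ν < ∞) (hN : N {u | 1 < ‖u‖} < ∞)

include hν hJ hN

lemma integrable_levyDom :
    Integrable (fun p : ℝ × E => levyDom p.1 p.2) ((volume.restrict (Ioi (0 : ℝ))).prod N) := by
  refine Integrable.add ?_ (integrable_truncWeight_mul_norm hN)
  have h1 : Integrable (fun u : E => min 1 (‖u‖ ^ 2)) ν := by
    refine ⟨Continuous.aestronglyMeasurable (by fun_prop), ?_⟩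
    rw [hasFiniteIntegral_iff_ofReal (ae_of_all _ fun u => by positivity)]
    exact hJ
  rw [hν] at h1
  exact h1.comp_measurable (by fun_prop)

lemma integrable_min_one_norm_sq : Integrable (fun u : E => min 1 (‖u‖ ^ 2)) N := by
  have h1 := (integrable_levyDom hν hJ hN).prod_right_ae
  have h2 := ae_restrict_mem (μ := volume) (measurableSet_Ioi (a := (0 : ℝ)))
  have : (ae (volume.restrict (Ioi (0 : ℝ)))).NeBot := ae_restrict_neBot.2 (by simp)
  obtain ⟨t, ht, ht0⟩ := (h1.and h2).exists
  refine (ht.const_mul (Real.exp t ^ 2)).mono' (Continuous.aestronglyMeasurable (by fun_prop))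
    (ae_of_all _ fun u => ?_)
  have h3 : 0 ≤ truncWeight t u * ‖u‖ := mul_nonneg (truncWeight_nonneg _ _) (norm_nonneg _)
  have h4 : 1 ≤ Real.exp t := Real.one_le_exp (mem_Ioi.1 ht0).le
  have h5 : ‖u‖ = Real.exp t * ‖Real.exp (-t) • u‖ := by
    rw [norm_smul, Real.norm_eq_abs, Real.abs_exp, ← mul_assoc, ← Real.exp_add]
    simp
  rw [Real.norm_of_nonneg (by positivity), levyDom]
  set v := ‖Real.exp (-t) • u‖
  calc min 1 (‖u‖ ^ 2) ≤ Real.exp t ^ 2 * min 1 (v ^ 2) := by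
        rw [h5, mul_min_of_nonneg _ _ (by positivity), mul_one, ← mul_pow]
        exact min_le_min_right _ (one_le_pow₀ h4)
    _ ≤ _ := by
        have : (0 : ℝ) < Real.exp t ^ 2 := by positivity
        nlinarith [mul_nonneg this.le h3]

lemma integrable_levyKernel_prod (ζ : E) :
    Integrable (fun p : ℝ × E => levyKernel (Real.exp (-p.1) • ζ) p.2)
      ((volume.restrict (Ioi (0 : ℝ))).prod N) := by
  refine ((integrable_levyDom hν hJ hN).const_mul (3 * (1 + ‖ζ‖ ^ 2))).mono'
    (measurable_levyKernel.comp
      (by fun_prop : Measurable fun p : ℝ × E => (Real.exp (-p.1) • ζ, p.2))).aestronglyMeasurable ?_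
  have h2 : ∀ᵐ p ∂(volume.restrict (Ioi (0 : ℝ))).prod N, p.1 ∈ Ioi (0 : ℝ) :=
    Measure.quasiMeasurePreserving_fst.ae (ae_restrict_mem measurableSet_Ioi)
  exact h2.mono fun p hp => norm_levyKernel_exp_smul_le ζ p.2 (mem_Ioi.1 hp).le

lemma continuous_integral_levyKernel : Continuous fun ζ => ∫ u, levyKernel ζ u ∂N := by
  rw [continuous_iff_continuousAt]
  intro ζ₀
  have hb := (integrable_min_one_norm_sq hν hJ hN).const_mul (3 * (1 + (‖ζ₀‖ + 1) ^ 2))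
  refine continuousAt_of_dominated (bound := fun u => 3 * (1 + (‖ζ₀‖ + 1) ^ 2) * min 1 (‖u‖ ^ 2))
    (Eventually.of_forall fun ζ => (measurable_levyKernel_right ζ).aestronglyMeasurable) ?_ hb
    (ae_of_all _ fun u => ?_)
  · filter_upwards [Metric.ball_mem_nhds ζ₀ one_pos] with ζ hζ
    refine ae_of_all _ fun u => ?_
    have h1 := norm_levyKernel_exp_smul_le ζ u le_rfl
    rw [neg_zero, Real.exp_zero, one_smul, levyDom_zero] at h1
    have h2 : ‖ζ‖ ≤ ‖ζ₀‖ + 1 := by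
      have h3 := norm_le_norm_add_norm_sub' ζ ζ₀
      have h4 : ‖ζ - ζ₀‖ < 1 := by rwa [← dist_eq_norm]
      linarith
    exact h1.trans (by gcongr)
  · unfold levyKernel
    by_cases h : ‖u‖ ≤ 1
    · simp only [if_pos h]
      fun_prop
    · simp only [if_neg h]
      fun_prop

omit hν hJ hN [FiniteDimensional ℝ E] [MeasurableSpace E] [BorelSpace E] [SFinite N] in
lemma integrableOn_I_mul_inner_exp_smul (c ζ : E) :
    IntegrableOn (fun s : ℝ => Complex.I * ((⟪c, Real.exp (-s) • ζ⟫ : ℝ) : ℂ)) (Ioi 0) := by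
  simp only [real_inner_smul_right]
  exact (((integrableOn_exp_neg_Ioi 0).mul_const ⟪c, ζ⟫).ofReal (𝕜 := ℂ)).const_mul Complex.I

omit hν hJ in
lemma integrable_truncWeight_mul_inner (ζ : E) :
    Integrable (fun p : ℝ × E => truncWeight p.1 p.2 * ⟪ζ, p.2⟫)
      ((volume.restrict (Ioi (0 : ℝ))).prod N) := by
  have hm : Measurable fun p : ℝ × E => truncWeight p.1 p.2 * ⟪ζ, p.2⟫ := by
    have := measurable_truncWeight (E := E)
    fun_prop
  refine ((integrable_truncWeight_mul_norm hN).const_mul ‖ζ‖).mono' hm.aestronglyMeasurable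
    (ae_of_all _ fun p => ?_)
  rw [norm_mul, Real.norm_of_nonneg (truncWeight_nonneg _ _)]
  nlinarith [mul_le_mul_of_nonneg_left (norm_inner_le_norm (𝕜 := ℝ) ζ p.2)
    (truncWeight_nonneg p.1 p.2)]

omit hν hJ in
lemma integral_truncWeight_mul_inner (ζ : E) :
    ∫ p, Complex.I * ((truncWeight p.1 p.2 * ⟪ζ, p.2⟫ : ℝ) : ℂ)
        ∂((volume.restrict (Ioi (0 : ℝ))).prod N)
      = Complex.I * ((⟪∫ u in {u | 1 < ‖u‖}, ‖u‖⁻¹ • u ∂N, ζ⟫ : ℝ) : ℂ) := by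
  have hset : MeasurableSet {u : E | 1 < ‖u‖} := measurableSet_lt measurable_const measurable_norm
  have hk : IntegrableOn (fun u : E => ‖u‖⁻¹ • u) {u | 1 < ‖u‖} N := by
    refine (integrableOn_const (C := (1 : ℝ)) hN.ne).mono'
      (by fun_prop : Measurable fun u : E => ‖u‖⁻¹ • u).aestronglyMeasurable
      (ae_of_all _ fun u => ?_)
    rw [norm_smul, norm_inv, norm_norm]
    exact inv_mul_le_one
  rw [integral_const_mul, integral_complex_ofReal, integral_prod_symm _
    (integrable_truncWeight_mul_inner hN ζ), real_inner_comm,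
    ← integral_inner hk]
  simp only [integral_mul_const, integral_truncWeight]
  rw [← integral_indicator hset]
  congr 3 with u
  by_cases h : u ∈ {u : E | 1 < ‖u‖}
  · rw [indicator_of_mem h, indicator_of_mem h, real_inner_smul_right]
  · rw [indicator_of_notMem h, indicator_of_notMem h, zero_mul]

omit hν hJ hN [FiniteDimensional ℝ E] [SFinite N] in
/-- The exponent of the infinitely divisible law with drift `c` and Lévy measure `N`. -/
def levyExponent (c : E) (N : Measure E) (ζ : E) : ℂ :=
  Complex.I * ((⟪c, ζ⟫ : ℝ) : ℂ) + ∫ u, levyKernel ζ u ∂N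

lemma continuous_levyExponent (c : E) : Continuous (levyExponent c N) :=
  Continuous.add (by fun_prop) (continuous_integral_levyKernel hν hJ hN)

lemma integrableOn_integral_levyKernel (ζ : E) :
    IntegrableOn (fun s : ℝ => ∫ u, levyKernel (Real.exp (-s) • ζ) u ∂N) (Ioi 0) :=
  (integrable_levyKernel_prod hν hJ hN ζ).integral_prod_left

lemma integrableOn_levyExponent (c ζ : E) :
    IntegrableOn (fun s : ℝ => levyExponent c N (Real.exp (-s) • ζ)) (Ioi 0) :=
  (integrableOn_I_mul_inner_exp_smul c ζ).add (integrableOn_integral_levyKernel hν hJ hN ζ)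

/-- The exponent of a self-decomposable law is obtained from the one of its background driving
Lévy process by integration along `s ↦ e^{-s} ζ`. -/
lemma levyExponent_eq_integral (b ζ : E) :
    levyExponent b ν ζ = ∫ s in Ioi (0 : ℝ),
      levyExponent (b - ∫ u in {u | 1 < ‖u‖}, ‖u‖⁻¹ • u ∂N) N (Real.exp (-s) • ζ) := by
  set c := b - ∫ u in {u | 1 < ‖u‖}, ‖u‖⁻¹ • u ∂N with hc
  have hK := integrable_levyKernel_prod hν hJ hN ζ
  have h1 : ∫ u, levyKernel ζ u ∂ν
      = (∫ s in Ioi (0 : ℝ), ∫ u, levyKernel (Real.exp (-s) • ζ) u ∂N)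
        - Complex.I * ((⟪b - c, ζ⟫ : ℝ) : ℂ) := by
    have hpos : ∀ᵐ p ∂(volume.restrict (Ioi (0 : ℝ))).prod N, p.1 ∈ Ioi (0 : ℝ) :=
      Measure.quasiMeasurePreserving_fst.ae (ae_restrict_mem measurableSet_Ioi)
    have hT : Integrable
        (fun p : ℝ × E => Complex.I * ((truncWeight p.1 p.2 * ⟪ζ, p.2⟫ : ℝ) : ℂ))
        ((volume.restrict (Ioi (0 : ℝ))).prod N) :=
      ((integrable_truncWeight_mul_inner hN ζ).ofReal (𝕜 := ℂ)).const_mul Complex.I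
    calc ∫ u, levyKernel ζ u ∂ν
        = ∫ p, levyKernel ζ (Real.exp (-p.1) • p.2) ∂(volume.restrict (Ioi (0 : ℝ))).prod N := by
          rw [hν]
          exact integral_map (by fun_prop) (measurable_levyKernel_right ζ).aestronglyMeasurable
      _ = ∫ p, (levyKernel (Real.exp (-p.1) • ζ) p.2
            - Complex.I * ((truncWeight p.1 p.2 * ⟪ζ, p.2⟫ : ℝ) : ℂ))
            ∂(volume.restrict (Ioi (0 : ℝ))).prod N :=
          integral_congr_ae
            (hpos.mono fun p hp => levyKernel_smul_right ζ p.2 (mem_Ioi.1 hp).le)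
      _ = _ := by
          rw [integral_sub hK hT, integral_truncWeight_mul_inner hN, integral_prod _ hK, hc,
            sub_sub_cancel]
  have h2 : ∫ s in Ioi (0 : ℝ), Complex.I * ((⟪c, Real.exp (-s) • ζ⟫ : ℝ) : ℂ)
      = Complex.I * ((⟪c, ζ⟫ : ℝ) : ℂ) := by
    simp only [real_inner_smul_right, Complex.ofReal_mul]
    rw [integral_const_mul, integral_mul_const, integral_complex_ofReal, integral_exp_neg_Ioi_zero]
    simp
  simp only [levyExponent]
  rw [integral_add (integrableOn_I_mul_inner_exp_smul c ζ)
    (integrableOn_integral_levyKernel hν hJ hN ζ), h1, h2, inner_sub_left]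
  push_cast
  ring

end Exponent

section PlaneWave

variable {E : Type*} [NormedAddCommGroup E] [InnerProductSpace ℝ E]

/-- The function `z ↦ e^{i⟪ζ, z⟫}`. -/
def planeWave (ζ z : E) : ℂ := Complex.exp (Complex.I * ((⟪ζ, z⟫ : ℝ) : ℂ))

lemma norm_planeWave (ζ z : E) : ‖planeWave ζ z‖ = 1 := by
  rw [planeWave, mul_comm, Complex.norm_exp_ofReal_mul_I]

lemma planeWave_add (ζ z w : E) : planeWave ζ (z + w) = planeWave ζ z * planeWave ζ w := by
  simp only [planeWave, inner_add_right, Complex.ofReal_add, mul_add, Complex.exp_add]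

lemma continuous_planeWave : Continuous fun p : E × E => planeWave p.1 p.2 := by
  unfold planeWave
  fun_prop

lemma levyKernel_eq (ζ u : E) : levyKernel ζ u
    = planeWave ζ u - 1 - (if ‖u‖ ≤ 1 then Complex.I * ((⟪ζ, u⟫ : ℝ) : ℂ) else 0) := rfl

variable [MeasurableSpace E]

lemma charFun_eq_integral_planeWave (μ : Measure E) (ζ : E) :
    charFun μ ζ = ∫ z, planeWave ζ z ∂μ := by
  rw [charFun_apply]
  refine integral_congr_ae (ae_of_all _ fun z => ?_)
  simp only [planeWave]
  rw [real_inner_comm, mul_comm]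

end PlaneWave

section TimeIntegral

variable {E : Type*} [NormedAddCommGroup E] [InnerProductSpace ℝ E] [FiniteDimensional ℝ E]
  [MeasurableSpace E] [BorelSpace E] {κ : Kernel ℝ E} [IsMarkovKernel κ] {η : E → ℂ} {μ : Measure E}

lemma setIntegral_Ioi_exp_neg_smul (t : ℝ) (ζ : E) :
    ∫ s in Ioi (0 : ℝ), η (Real.exp (-s) • Real.exp (-t) • ζ)
      = ∫ s in Ioi t, η (Real.exp (-s) • ζ) := by
  have h := (measurePreserving_add_right volume t).setIntegral_preimage_emb
    (measurableEmbedding_addRight t) (fun s => η (Real.exp (-s) • ζ)) (Ioi t)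
  rw [preimage_add_const_Ioi, sub_self] at h
  rw [← h]
  congr 1 with s
  rw [smul_smul, ← Real.exp_add, neg_add]

lemma integral_timeLaw_planeWave_mul (hη : Continuous η)
    (hηi : ∀ ζ, IntegrableOn (fun s : ℝ => η (Real.exp (-s) • ζ)) (Ioi 0))
    (hκ : ∀ t, 0 ≤ t → ∀ ζ, charFun (κ t) ζ = Complex.exp (∫ s in (0 : ℝ)..t, η (Real.exp (-s) • ζ)))
    (hμ : ∀ ζ, charFun μ ζ = Complex.exp (∫ s in Ioi (0 : ℝ), η (Real.exp (-s) • ζ))) (ζ x : E) :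
    ∫ p, planeWave ζ (Real.exp (-p.1) • x + p.2)
        * (η (Real.exp (-p.1) • ζ) - Complex.I * ((⟪x, Real.exp (-p.1) • ζ⟫ : ℝ) : ℂ)) ∂timeLaw κ
      = charFun μ ζ - planeWave ζ x := by
  have hx := integrableOn_I_mul_inner_exp_smul x ζ
  have hq := (hηi ζ).sub hx
  have hpi : Integrable (fun p : ℝ × E => planeWave ζ (Real.exp (-p.1) • x + p.2)
      * (η (Real.exp (-p.1) • ζ) - Complex.I * ((⟪x, Real.exp (-p.1) • ζ⟫ : ℝ) : ℂ)))
      (timeLaw κ) := by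
    refine (integrable_timeLaw_comp_fst κ hq).bdd_mul (c := 1)
      (Continuous.aestronglyMeasurable ?_) (ae_of_all _ fun p => (norm_planeWave _ _).le)
    exact continuous_planeWave.comp
      (by fun_prop : Continuous fun p : ℝ × E => (ζ, Real.exp (-p.1) • x + p.2))
  rw [Measure.integral_compProd hpi]
  set Φ : ℝ → ℂ := fun t => planeWave ζ (Real.exp (-t) • x)
    * Complex.exp (∫ s in (0 : ℝ)..t, η (Real.exp (-s) • ζ)) with hΦ
  set Φ' : ℝ → ℂ := fun t => Φ t
    * (η (Real.exp (-t) • ζ) - Complex.I * ((⟪x, Real.exp (-t) • ζ⟫ : ℝ) : ℂ)) with hΦ'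
  have hcη : Continuous fun s : ℝ => η (Real.exp (-s) • ζ) := by fun_prop
  have h1 : ∀ t ∈ Ioi (0 : ℝ), ∫ y, planeWave ζ (Real.exp (-t) • x + y)
      * (η (Real.exp (-t) • ζ) - Complex.I * ((⟪x, Real.exp (-t) • ζ⟫ : ℝ) : ℂ)) ∂κ t = Φ' t := by
    intro t ht
    rw [integral_mul_const]
    simp only [planeWave_add]
    rw [integral_const_mul, ← charFun_eq_integral_planeWave, hκ t (mem_Ioi.1 ht).le]
  have hder : ∀ t, HasDerivAt Φ (Φ' t) t := by
    intro t
    have hi : HasDerivAt (fun t => ∫ s in (0 : ℝ)..t, η (Real.exp (-s) • ζ))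
        (η (Real.exp (-t) • ζ)) t := hcη.integral_hasStrictDerivAt 0 t |>.hasDerivAt
    have he : HasDerivAt (fun t : ℝ => Complex.I * ((⟪ζ, Real.exp (-t) • x⟫ : ℝ) : ℂ))
        (-(Complex.I * ((⟪x, Real.exp (-t) • ζ⟫ : ℝ) : ℂ))) t := by
      have h2 := ((hasDerivAt_neg t).exp.mul_const ⟪ζ, x⟫).ofReal_comp.const_mul Complex.I
      refine (h2.congr_deriv ?_).congr_of_eventuallyEq (Eventually.of_forall fun s => ?_)
      · rw [real_inner_smul_right, real_inner_comm]
        push_cast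
        ring
      · simp only [real_inner_smul_right]
    refine (he.cexp.mul hi.cexp).congr_deriv ?_
    simp only [hΦ', hΦ, planeWave]
    ring
  have hΦ'i : IntegrableOn Φ' (Ioi 0) := by
    refine Integrable.bdd_mul (c := 1) hq
      (Continuous.aestronglyMeasurable (continuous_iff_continuousAt.2 fun t => (hder t).continuousAt))
      ((ae_restrict_mem measurableSet_Ioi).mono fun t ht => ?_)
    rw [hΦ]
    simp only
    rw [← hκ t (mem_Ioi.1 ht).le, norm_mul, norm_planeWave, one_mul]
    exact norm_charFun_le_one _
  have htend : Tendsto Φ atTop (𝓝 (charFun μ ζ)) := by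
    have h2 := intervalIntegral_tendsto_integral_Ioi 0 (hηi ζ) tendsto_id
    have h3 : Tendsto (fun t : ℝ => planeWave ζ (Real.exp (-t) • x)) atTop
        (𝓝 (planeWave ζ ((0 : ℝ) • x))) := by
      refine ((continuous_planeWave.comp (by fun_prop : Continuous fun a : ℝ => (ζ, a • x))).tendsto
        0).comp ?_
      exact Real.tendsto_exp_neg_atTop_nhds_zero
    have h4 := h3.mul ((Complex.continuous_exp.tendsto _).comp h2)
    rw [← hμ] at h4
    simpa [planeWave, hΦ] using h4
  rw [setIntegral_congr_fun measurableSet_Ioi h1,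
    integral_Ioi_of_hasDerivAt_of_tendsto' (fun t _ => hder t) hΦ'i htend]
  simp [hΦ]

end TimeIntegral

section Fourier

open scoped FourierTransform in
/-- A compactly supported smooth function is a superposition of plane waves with an amplitude
having a second moment. -/
lemma exists_planeWave_representation {E : Type*} [NormedAddCommGroup E] [InnerProductSpace ℝ E]
    [FiniteDimensional ℝ E] [MeasurableSpace E] [BorelSpace E] {h : E → ℝ}
    (hs : ContDiff ℝ (⊤ : ℕ∞) h) (hc : HasCompactSupport h) :
    ∃ H : E → ℂ, Continuous H ∧ Integrable (fun ζ => (1 + ‖ζ‖ ^ 2) * ‖H ζ‖) ∧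
      ∀ z, (h z : ℂ) = ∫ ζ, H ζ * planeWave ζ z := by
  have hs' : ContDiff ℝ (⊤ : ℕ∞) fun z => (h z : ℂ) := Complex.ofRealCLM.contDiff.comp hs
  have hc' : HasCompactSupport fun z => (h z : ℂ) := hc.comp_left Complex.ofReal_zero
  set f : SchwartzMap E ℂ := hc'.toSchwartzMap hs' with hf
  set g : SchwartzMap E ℂ := 𝓕 f with hg
  set a : ℝ := 2 * Real.pi with ha
  have ha0 : a ≠ 0 := by positivity
  set c : ℝ := |(a⁻¹ ^ Module.finrank ℝ E)| with hcdef
  refine ⟨fun ζ => (c : ℂ) * g (a⁻¹ • ζ), by fun_prop, ?_, fun z => ?_⟩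
  · have h1 : Integrable fun ξ : E => (1 + ‖a • ξ‖ ^ 2) * ‖(c : ℂ) * g ξ‖ := by
      have h2 := ((g.integrable_pow_mul volume 0).add
        ((g.integrable_pow_mul volume 2).const_mul (‖a‖ ^ 2))).const_mul ‖(c : ℂ)‖
      refine h2.congr (ae_of_all _ fun ξ => ?_)
      simp only [Pi.add_apply, norm_smul, norm_mul]
      ring
    have h3 := h1.comp_smul (inv_ne_zero ha0)
    simpa only [smul_inv_smul₀ ha0] using h3
  · have h1 : (𝓕⁻ g : SchwartzMap E ℂ) z = (h z : ℂ) := by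
      rw [hg, FourierTransform.fourierInv_fourier_eq]
      rfl
    have h2 : (𝓕⁻ g : SchwartzMap E ℂ) z = ∫ ξ, g ξ * planeWave (a • ξ) z := by
      rw [SchwartzMap.fourierInv_coe, Real.fourierInv_eq']
      refine integral_congr_ae (ae_of_all _ fun ξ => ?_)
      simp only [planeWave, real_inner_smul_left, smul_eq_mul, ha]
      rw [mul_comm (g ξ), mul_comm Complex.I]
    have h3 := Measure.integral_comp_smul (volume : Measure E)
      (fun ζ => g (a⁻¹ • ζ) * planeWave ζ z) a
    simp only [inv_smul_smul₀ ha0] at h3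
    rw [← h1, h2, h3, Complex.real_smul, ← integral_const_mul]
    simp only [hcdef, mul_assoc, inv_pow]

variable {E : Type*} [NormedAddCommGroup E] [InnerProductSpace ℝ E] [FiniteDimensional ℝ E]
  [MeasurableSpace E] [BorelSpace E] {h : E → ℝ} {H : E → ℂ}

lemma integrable_of_integrable_one_add_norm_sq_mul (hHc : Continuous H)
    (hH : Integrable (fun ζ => (1 + ‖ζ‖ ^ 2) * ‖H ζ‖)) : Integrable H :=
  hH.mono' hHc.aestronglyMeasurable
    (ae_of_all _ fun ζ => by nlinarith [mul_nonneg (sq_nonneg ‖ζ‖) (norm_nonneg (H ζ))])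

lemma integrable_norm_mul_of_integrable_one_add_norm_sq_mul (hHc : Continuous H)
    (hH : Integrable (fun ζ => (1 + ‖ζ‖ ^ 2) * ‖H ζ‖)) : Integrable fun ζ => ‖ζ‖ * ‖H ζ‖ :=
  hH.mono' (Continuous.aestronglyMeasurable (by fun_prop)) (ae_of_all _ fun ζ => by
    rw [Real.norm_of_nonneg (by positivity)]
    exact mul_le_mul_of_nonneg_right (by nlinarith [sq_nonneg (‖ζ‖ - 1), sq_nonneg ‖ζ‖])
      (norm_nonneg _))

lemma fderiv_apply_eq_integral_planeWave (hd : Differentiable ℝ h) (hHc : Continuous H)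
    (hH : Integrable (fun ζ => (1 + ‖ζ‖ ^ 2) * ‖H ζ‖))
    (hrep : ∀ z, (h z : ℂ) = ∫ ζ, H ζ * planeWave ζ z) (z u : E) :
    ((fderiv ℝ h z u : ℝ) : ℂ)
      = ∫ ζ, H ζ * (planeWave ζ z * (Complex.I * ((⟪ζ, u⟫ : ℝ) : ℂ))) := by
  have hw : ∀ s : ℝ, Continuous fun ζ => planeWave ζ (z + s • u) := fun s =>
    continuous_planeWave.comp (by fun_prop : Continuous fun ζ : E => (ζ, z + s • u))
  have hi : ∀ s : ℝ, Integrable fun ζ => H ζ * planeWave ζ (z + s • u) := fun s =>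
    (integrable_of_integrable_one_add_norm_sq_mul hHc hH).mul_bdd (c := 1)
      (hw s).aestronglyMeasurable (ae_of_all _ fun ζ => (norm_planeWave _ _).le)
  have hb := (integrable_norm_mul_of_integrable_one_add_norm_sq_mul hHc hH).const_mul ‖u‖
  have h1 := (hasDerivAt_integral_of_dominated_loc_of_deriv_le (μ := (volume : Measure E))
    (F := fun (s : ℝ) ζ => H ζ * planeWave ζ (z + s • u))
    (F' := fun (s : ℝ) ζ => H ζ * (planeWave ζ (z + s • u) * (Complex.I * ((⟪ζ, u⟫ : ℝ) : ℂ))))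
    (x₀ := 0) (bound := fun ζ => ‖u‖ * (‖ζ‖ * ‖H ζ‖)) univ_mem
    (Eventually.of_forall fun s => (hi s).aestronglyMeasurable) (hi 0)
    (Continuous.aestronglyMeasurable (by have := hw 0; fun_prop))
    (ae_of_all _ fun ζ s _ => ?_) hb (ae_of_all _ fun ζ s _ => ?_)).2
  · have h2 : HasDerivAt (fun s : ℝ => h (z + s • u)) (fderiv ℝ h z u) 0 := by
      have h3 : HasDerivAt (fun s : ℝ => z + s • u) u 0 := by
        simpa using ((hasDerivAt_id (0 : ℝ)).smul_const u).const_add z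
      have h4 : HasFDerivAt h (fderiv ℝ h z) (z + (0 : ℝ) • u) := by
        simpa using (hd z).hasFDerivAt
      exact h4.comp_hasDerivAt 0 h3
    simp only [← hrep] at h1
    have h5 := h2.ofReal_comp.unique h1
    simpa using h5
  · rw [norm_mul, norm_mul, norm_planeWave, one_mul, norm_mul, Complex.norm_I, one_mul,
      Complex.norm_real]
    nlinarith [mul_le_mul_of_nonneg_left (norm_inner_le_norm (𝕜 := ℝ) ζ u) (norm_nonneg (H ζ))]
  · refine HasDerivAt.const_mul _ ?_
    have h2 : HasDerivAt (fun s : ℝ => ⟪ζ, z + s • u⟫) ⟪ζ, u⟫ s := by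
      simp only [inner_add_right, real_inner_smul_right]
      simpa using ((hasDerivAt_id s).mul_const ⟪ζ, u⟫).const_add ⟪ζ, z⟫
    exact (h2.ofReal_comp.const_mul Complex.I).cexp

end Fourier

section SteinEquation

variable {E : Type*} [NormedAddCommGroup E] [InnerProductSpace ℝ E] [FiniteDimensional ℝ E]
  [MeasurableSpace E] [BorelSpace E] {h : E → ℝ} {H : E → ℂ}

lemma integrable_mul_planeWave (hHc : Continuous H)
    (hH : Integrable (fun ζ => (1 + ‖ζ‖ ^ 2) * ‖H ζ‖)) (z : E) :
    Integrable fun ζ => H ζ * planeWave ζ z :=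
  (integrable_of_integrable_one_add_norm_sq_mul hHc hH).mul_bdd (c := 1)
    (continuous_planeWave.comp
      (by fun_prop : Continuous fun ζ : E => (ζ, z))).aestronglyMeasurable
    (ae_of_all _ fun ζ => (norm_planeWave _ _).le)

lemma integrable_mul_planeWave_mul_inner (hHc : Continuous H)
    (hH : Integrable (fun ζ => (1 + ‖ζ‖ ^ 2) * ‖H ζ‖)) (z u : E) :
    Integrable fun ζ => H ζ * (planeWave ζ z * (Complex.I * ((⟪ζ, u⟫ : ℝ) : ℂ))) := by
  have hw : Continuous fun ζ => planeWave ζ z :=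
    continuous_planeWave.comp (by fun_prop : Continuous fun ζ : E => (ζ, z))
  refine ((integrable_norm_mul_of_integrable_one_add_norm_sq_mul hHc hH).const_mul ‖u‖).mono'
    (Continuous.aestronglyMeasurable (by fun_prop)) (ae_of_all _ fun ζ => ?_)
  rw [norm_mul, norm_mul, norm_planeWave, one_mul, norm_mul, Complex.norm_I, one_mul,
    Complex.norm_real]
  nlinarith [mul_le_mul_of_nonneg_left (norm_inner_le_norm (𝕜 := ℝ) ζ u) (norm_nonneg (H ζ))]

/-- The compensated increment of a superposition of plane waves. -/
lemma compensated_increment_eq_integral (hd : Differentiable ℝ h) (hHc : Continuous H)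
    (hH : Integrable (fun ζ => (1 + ‖ζ‖ ^ 2) * ‖H ζ‖))
    (hrep : ∀ z, (h z : ℂ) = ∫ ζ, H ζ * planeWave ζ z) (a : ℝ) (z u : E) :
    ((h (z + a • u) - h z - (if ‖u‖ ≤ 1 then a * fderiv ℝ h z u else 0) : ℝ) : ℂ)
      = ∫ ζ, H ζ * (planeWave ζ z * levyKernel (a • ζ) u) := by
  have hin : ∀ ζ, ⟪a • ζ, u⟫ = ⟪ζ, a • u⟫ := fun ζ => by
    rw [real_inner_smul_left, real_inner_smul_right]
  have hi1 := integrable_mul_planeWave hHc hH (z + a • u)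
  have hi2 := integrable_mul_planeWave hHc hH z
  have hi3 := integrable_mul_planeWave_mul_inner hHc hH z (a • u)
  have h1 : ((a * fderiv ℝ h z u : ℝ) : ℂ)
      = ∫ ζ, H ζ * (planeWave ζ z * (Complex.I * ((⟪ζ, a • u⟫ : ℝ) : ℂ))) := by
    rw [← fderiv_apply_eq_integral_planeWave hd hHc hH hrep, map_smul, smul_eq_mul]
  have hpw : ∀ ζ, planeWave (a • ζ) u = planeWave ζ (a • u) := fun ζ => by
    rw [planeWave, planeWave, hin]
  by_cases hu : ‖u‖ ≤ 1
  · simp only [levyKernel_eq, if_pos hu, hin, hpw]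
    have hi12 : Integrable fun ζ => H ζ * planeWave ζ (z + a • u) - H ζ * planeWave ζ z :=
      hi1.sub hi2
    rw [Complex.ofReal_sub, Complex.ofReal_sub, h1, hrep, hrep, ← integral_sub hi1 hi2,
      ← integral_sub hi12 hi3]
    refine integral_congr_ae (ae_of_all _ fun ζ => ?_)
    simp only [planeWave_add]
    ring
  · simp only [levyKernel_eq, if_neg hu, hpw]
    rw [sub_zero, Complex.ofReal_sub, hrep, hrep, ← integral_sub hi1 hi2]
    refine integral_congr_ae (ae_of_all _ fun ζ => ?_)
    simp only [planeWave_add]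
    ring

variable {κ : Kernel ℝ E} [IsMarkovKernel κ] {ν N μ : Measure E} [SFinite N]
  [IsProbabilityMeasure μ]

lemma integral_mul_charFun (hHc : Continuous H)
    (hH : Integrable (fun ζ => (1 + ‖ζ‖ ^ 2) * ‖H ζ‖))
    (hrep : ∀ z, (h z : ℂ) = ∫ ζ, H ζ * planeWave ζ z) :
    ∫ ζ, H ζ * charFun μ ζ = ((∫ z, h z ∂μ : ℝ) : ℂ) := by
  have hi : Integrable (fun p : E × E => H p.2 * planeWave p.2 p.1) (μ.prod volume) := by
    have h1 := (integrable_of_integrable_one_add_norm_sq_mul hHc hH).comp_snd μ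
    exact h1.mul_bdd (c := 1) (continuous_planeWave.comp continuous_swap).aestronglyMeasurable
      (ae_of_all _ fun ζ => (norm_planeWave _ _).le)
  rw [← integral_complex_ofReal]
  simp only [hrep, charFun_eq_integral_planeWave, ← integral_const_mul]
  exact (integral_integral_swap (f := fun z ζ => H ζ * planeWave ζ z) hi).symm

variable (hν : ν = ((volume.restrict (Ioi (0 : ℝ))).prod N).map
    (fun p => Real.exp (-p.1) • p.2))
  (hJ : ∫⁻ u, ENNReal.ofReal (min 1 (‖u‖ ^ 2)) ∂ν < ∞) (hN : N {u | 1 < ‖u‖} < ∞)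

include hν hJ hN

variable (κ) in
lemma integrable_levyDom_timeLaw :
    Integrable (fun q : E × (ℝ × E) => levyDom q.2.1 q.1) (N.prod (timeLaw κ)) := by
  have h1 := (integrable_levyDom hν hJ hN).swap
  have h2 : N.prod (volume.restrict (Ioi (0 : ℝ)))
      = (N.prod (timeLaw κ)).map (Prod.map id Prod.fst) := by
    rw [← Measure.map_prod_map _ _ measurable_id measurable_fst, Measure.map_id, map_fst_timeLaw]
  rw [h2] at h1
  exact h1.comp_measurable (by fun_prop)

lemma integrable_steinIntegrand (hHc : Continuous H)
    (hH : Integrable (fun ζ => (1 + ‖ζ‖ ^ 2) * ‖H ζ‖)) (x : E) :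
    Integrable (fun q : E × ((ℝ × E) × E) => H q.2.2
      * (planeWave q.2.2 (Real.exp (-q.2.1.1) • x + q.2.1.2)
        * levyKernel (Real.exp (-q.2.1.1) • q.2.2) q.1)) (N.prod ((timeLaw κ).prod volume)) := by
  have h1 := (integrable_levyDom_timeLaw κ hν hJ hN).mul_prod (hH.const_mul 3)
  have h2 : Integrable (fun q : E × ((ℝ × E) × E) =>
      levyDom q.2.1.1 q.1 * (3 * ((1 + ‖q.2.2‖ ^ 2) * ‖H q.2.2‖)))
      (N.prod ((timeLaw κ).prod volume)) :=
    ((measurePreserving_prodAssoc N (timeLaw κ) volume).integrable_comp_emb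
      MeasurableEquiv.prodAssoc.measurableEmbedding).1 h1
  have hpos : ∀ᵐ q ∂N.prod ((timeLaw κ).prod (volume : Measure E)), 0 < q.2.1.1 :=
    Measure.quasiMeasurePreserving_snd.ae
      (Measure.quasiMeasurePreserving_fst.ae (ae_timeLaw_pos κ))
  refine h2.mono' (Measurable.aestronglyMeasurable ?_) (hpos.mono fun q hq => ?_)
  · have hf1 : Measurable fun q : E × ((ℝ × E) × E) => (Real.exp (-q.2.1.1) • q.2.2, q.1) := by
      fun_prop
    have hf2 : Measurable fun q : E × ((ℝ × E) × E) =>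
        (q.2.2, Real.exp (-q.2.1.1) • x + q.2.1.2) := by fun_prop
    have hm1 := measurable_levyKernel.comp hf1
    have hm2 := continuous_planeWave.measurable.comp hf2
    exact (hHc.measurable.comp (by fun_prop)).mul (hm2.mul hm1)
  · rw [norm_mul, norm_mul, norm_planeWave, one_mul]
    have h3 := mul_le_mul_of_nonneg_left (norm_levyKernel_exp_smul_le q.2.2 q.1 hq.le)
      (norm_nonneg (H q.2.2))
    exact h3.trans (le_of_eq (by ring))

/-- The generator of the semigroup, integrated in time, applied to `h`. -/
lemma drift_add_jump_eq (c : E)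
    (hκ : ∀ t, 0 ≤ t → ∀ ζ, charFun (κ t) ζ
      = Complex.exp (∫ s in (0 : ℝ)..t, levyExponent c N (Real.exp (-s) • ζ)))
    (hμ : ∀ ζ, charFun μ ζ
      = Complex.exp (∫ s in Ioi (0 : ℝ), levyExponent c N (Real.exp (-s) • ζ)))
    (hd : Differentiable ℝ h) (hHc : Continuous H)
    (hH : Integrable (fun ζ => (1 + ‖ζ‖ ^ 2) * ‖H ζ‖))
    (hrep : ∀ z, (h z : ℂ) = ∫ ζ, H ζ * planeWave ζ z) (x : E) :
    ∫ p, Real.exp (-p.1) * fderiv ℝ h (Real.exp (-p.1) • x + p.2) (c - x) ∂timeLaw κ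
      + ∫ u, ∫ p, (h (Real.exp (-p.1) • x + p.2 + Real.exp (-p.1) • u)
        - h (Real.exp (-p.1) • x + p.2)
        - (if ‖u‖ ≤ 1 then Real.exp (-p.1) * fderiv ℝ h (Real.exp (-p.1) • x + p.2) u else 0))
          ∂timeLaw κ ∂N
      = ∫ z, h z ∂μ - h x := by
  set F : E → (ℝ × E) × E → ℂ := fun u q => H q.2
      * (planeWave q.2 (Real.exp (-q.1.1) • x + q.1.2)
        * levyKernel (Real.exp (-q.1.1) • q.2) u) with hFdef
  set L : (ℝ × E) × E → ℂ := fun q => H q.2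
      * (planeWave q.2 (Real.exp (-q.1.1) • x + q.1.2)
        * (Complex.I * ((⟪q.2, Real.exp (-q.1.1) • (c - x)⟫ : ℝ) : ℂ))) with hLdef
  have hF : Integrable (Function.uncurry F) (N.prod ((timeLaw κ).prod volume)) :=
    integrable_steinIntegrand hν hJ hN hHc hH x
  have hL : Integrable L ((timeLaw κ).prod volume) := by
    have h1 := (integrable_timeLaw_comp_fst κ (integrableOn_exp_neg_Ioi 0)).mul_prod
      ((integrable_norm_mul_of_integrable_one_add_norm_sq_mul hHc hH).const_mul ‖c - x‖)
    have hw : Continuous fun q : (ℝ × E) × E => planeWave q.2 (Real.exp (-q.1.1) • x + q.1.2) :=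
      continuous_planeWave.comp (by fun_prop :
        Continuous fun q : (ℝ × E) × E => (q.2, Real.exp (-q.1.1) • x + q.1.2))
    refine h1.mono' (Continuous.aestronglyMeasurable (by fun_prop)) (ae_of_all _ fun q => ?_)
    rw [hLdef]
    simp only
    rw [norm_mul, norm_mul, norm_planeWave, one_mul, norm_mul, Complex.norm_I, one_mul,
      Complex.norm_real, real_inner_smul_right, norm_mul, Real.norm_eq_abs, Real.abs_exp]
    have h2 := mul_le_mul_of_nonneg_left (norm_inner_le_norm (𝕜 := ℝ) q.2 (c - x))
      (mul_nonneg (norm_nonneg (H q.2)) (Real.exp_pos (-q.1.1)).le)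
    linarith
  have hjump : ((∫ u, ∫ p, (h (Real.exp (-p.1) • x + p.2 + Real.exp (-p.1) • u)
        - h (Real.exp (-p.1) • x + p.2)
        - (if ‖u‖ ≤ 1 then Real.exp (-p.1) * fderiv ℝ h (Real.exp (-p.1) • x + p.2) u else 0))
          ∂timeLaw κ ∂N : ℝ) : ℂ)
      = ∫ q, ∫ u, F u q ∂N ∂(timeLaw κ).prod volume := by
    rw [← integral_integral_swap hF, ← integral_complex_ofReal]
    refine integral_congr_ae (hF.prod_right_ae.mono fun u hu => ?_)
    simp only
    rw [← integral_complex_ofReal]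
    simp only [compensated_increment_eq_integral hd hHc hH hrep]
    exact (integral_prod _ hu).symm
  have hdrift : ((∫ p, Real.exp (-p.1) * fderiv ℝ h (Real.exp (-p.1) • x + p.2) (c - x)
      ∂timeLaw κ : ℝ) : ℂ) = ∫ q, L q ∂(timeLaw κ).prod volume := by
    rw [integral_prod _ hL, ← integral_complex_ofReal]
    refine integral_congr_ae (ae_of_all _ fun p => ?_)
    simp only [hLdef]
    rw [← fderiv_apply_eq_integral_planeWave hd hHc hH hrep, map_smul, smul_eq_mul]
  have hsum : ∀ q : (ℝ × E) × E, L q + ∫ u, F u q ∂N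
      = H q.2 * (planeWave q.2 (Real.exp (-q.1.1) • x + q.1.2)
        * (levyExponent c N (Real.exp (-q.1.1) • q.2)
          - Complex.I * ((⟪x, Real.exp (-q.1.1) • q.2⟫ : ℝ) : ℂ))) := by
    intro q
    simp only [hFdef, hLdef, levyExponent]
    rw [integral_const_mul, integral_const_mul, real_inner_smul_right, inner_sub_right,
      real_inner_smul_right, real_inner_smul_right, real_inner_comm c, real_inner_comm x]
    push_cast
    ring
  have hJi : Integrable (fun q => ∫ u, F u q ∂N) ((timeLaw κ).prod volume) :=
    hF.integral_prod_right
  have hηi : Integrable (fun q => L q + ∫ u, F u q ∂N) ((timeLaw κ).prod volume) := hL.add hJi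
  have h1 := integrable_mul_planeWave hHc hH x
  have h2 : Integrable fun ζ => H ζ * charFun μ ζ :=
    (integrable_of_integrable_one_add_norm_sq_mul hHc hH).mul_bdd (c := 1)
      stronglyMeasurable_charFun.aestronglyMeasurable
      (ae_of_all _ fun ζ => norm_charFun_le_one ζ)
  rw [← Complex.ofReal_inj, Complex.ofReal_add, hjump, hdrift,
    ← integral_add hL hJi]
  refine (integral_prod_symm _ hηi).trans ?_
  simp only [hsum, integral_const_mul]
  simp only [integral_timeLaw_planeWave_mul (continuous_levyExponent hν hJ hN c)
    (integrableOn_levyExponent hν hJ hN c) hκ hμ]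
  simp only [mul_sub]
  rw [integral_sub h2 h1, integral_mul_charFun hHc hH hrep, ← hrep, Complex.ofReal_sub]

end SteinEquation

section StationaryLaw

variable {d : ℕ} {μX : Measure (EuclideanSpace ℝ (Fin d))} [IsProbabilityMeasure μX]
  {μt : ℝ → Measure (EuclideanSpace ℝ (Fin d))} {η : EuclideanSpace ℝ (Fin d) → ℂ}

lemma charFun_eq_charFn (μ : Measure (EuclideanSpace ℝ (Fin d))) (ξ : EuclideanSpace ℝ (Fin d)) :
    charFun μ ξ = charFn μ ξ :=
  charFun_eq_integral_planeWave μ ξ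

lemma charFun_eq_exp_intervalIntegral
    (hηi : ∀ ζ, IntegrableOn (fun s : ℝ => η (Real.exp (-s) • ζ)) (Ioi 0))
    (hX : ∀ ζ, charFun μX ζ = Complex.exp (∫ s in Ioi (0 : ℝ), η (Real.exp (-s) • ζ)))
    (hμt : ∀ t : ℝ, 0 ≤ t → ∀ ξ, charFn (μt t) ξ = charFn μX ξ / charFn μX (Real.exp (-t) • ξ))
    {t : ℝ} (ht : 0 ≤ t) (ζ : EuclideanSpace ℝ (Fin d)) :
    charFun (μt t) ζ = Complex.exp (∫ s in (0 : ℝ)..t, η (Real.exp (-s) • ζ)) := by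
  rw [charFun_eq_charFn, hμt t ht, ← charFun_eq_charFn, ← charFun_eq_charFn, hX, hX,
    ← Complex.exp_sub, setIntegral_Ioi_exp_neg_smul,
    intervalIntegral.integral_Ioi_sub_Ioi (hηi ζ) ht]

lemma continuousOn_charFun_of_eq_exp
    (hη : Continuous η)
    (hμt : ∀ t : ℝ, 0 ≤ t → ∀ ζ,
      charFun (μt t) ζ = Complex.exp (∫ s in (0 : ℝ)..t, η (Real.exp (-s) • ζ)))
    (ξ : EuclideanSpace ℝ (Fin d)) : ContinuousOn (fun t => charFun (μt t) ξ) (Ici 0) := by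
  have hc : Continuous fun t : ℝ => ∫ s in (0 : ℝ)..t, η (Real.exp (-s) • ξ) :=
    intervalIntegral.continuous_primitive
      (fun a b => (by fun_prop : Continuous fun s : ℝ => η (Real.exp (-s) • ξ)).intervalIntegrable
        a b) 0
  exact (Complex.continuous_exp.comp hc).continuousOn.congr fun t ht => hμt t ht ξ

lemma map_exp_smul_conv_eq {t : ℝ} [IsProbabilityMeasure (μt t)]
    (hX : ∀ ξ, charFun μX ξ ≠ 0)
    (hμt : ∀ ξ, charFn (μt t) ξ = charFn μX ξ / charFn μX (Real.exp (-t) • ξ)) :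
    μX.map (fun z => Real.exp (-t) • z) ∗ μt t = μX := by
  have : IsProbabilityMeasure (μX.map fun z => Real.exp (-t) • z) :=
    Measure.isProbabilityMeasure_map (by fun_prop)
  refine Measure.ext_of_charFun (funext fun ξ => ?_)
  rw [charFun_conv, charFun_map_smul, charFun_eq_charFn (μt t), hμt, ← charFun_eq_charFn,
    ← charFun_eq_charFn, mul_div_cancel₀ _ (hX _)]

end StationaryLaw

section SteinSolution

variable {d : ℕ} {μX : Measure (EuclideanSpace ℝ (Fin d))} [IsProbabilityMeasure μX]
  {μt : ℝ → Measure (EuclideanSpace ℝ (Fin d))} {h : EuclideanSpace ℝ (Fin d) → ℝ} {ε : ℝ}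
  (κ : Kernel ℝ (EuclideanSpace ℝ (Fin d))) [IsMarkovKernel κ]

lemma integral_exp_smul_fderiv_apply (hd : ContDiff ℝ 1 h) (h1 : ∀ x, ‖fderiv ℝ h x‖ ≤ 1)
    (x v : EuclideanSpace ℝ (Fin d)) :
    Integrable (fun p : ℝ × EuclideanSpace ℝ (Fin d) =>
        Real.exp (-p.1) * fderiv ℝ h (Real.exp (-p.1) • x + p.2) v) (timeLaw κ) ∧
      (∫ p, Real.exp (-1 * p.1) • fderiv ℝ h (Real.exp (-p.1) • x + p.2) ∂timeLaw κ) v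
        = ∫ p, Real.exp (-p.1) * fderiv ℝ h (Real.exp (-p.1) • x + p.2) v ∂timeLaw κ := by
  have hi := integrable_exp_smul κ (hd.continuous_fderiv one_ne_zero) h1 one_pos x
  have hv := hi.apply_continuousLinearMap v
  rw [ContinuousLinearMap.integral_apply hi]
  simp only [smul_apply, smul_eq_mul, neg_one_mul] at hv ⊢
  exact ⟨hv, trivial⟩

lemma steinSol_compensated_increment (hκ : ∀ t, 0 ≤ t → κ t = μt t)
    (hself : ∀ t, 0 ≤ t → μX.map (fun z => Real.exp (-t) • z) ∗ μt t = μX)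
    (hε : ε ∈ Ioo (0 : ℝ) 1) (hmom : Integrable (fun z => ‖z‖ ^ ε) μX)
    (hd : ContDiff ℝ 1 h) (h0 : ∀ x, |h x| ≤ 1) (h1 : ∀ x, ‖fderiv ℝ h x‖ ≤ 1)
    (x u : EuclideanSpace ℝ (Fin d)) :
    steinSol μX μt h (x + u) - steinSol μX μt h x
        - (if ‖u‖ ≤ 1 then fderiv ℝ (steinSol μX μt h) x u else 0)
      = -∫ p, (h (Real.exp (-p.1) • x + p.2 + Real.exp (-p.1) • u)
        - h (Real.exp (-p.1) • x + p.2)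
        - (if ‖u‖ ≤ 1 then Real.exp (-p.1) * fderiv ℝ h (Real.exp (-p.1) • x + p.2) u else 0))
          ∂timeLaw κ := by
  have hs := steinSol_eq κ hκ hself hε hmom hd h0 h1
  have hiu := integrable_timeLaw_increment κ hd h0 h1 (x + u)
  have hix := integrable_timeLaw_increment κ hd h0 h1 x
  have hA : Integrable (fun p : ℝ × EuclideanSpace ℝ (Fin d) =>
      h (Real.exp (-p.1) • (x + u) + p.2) - h p.2
        - (h (Real.exp (-p.1) • x + p.2) - h p.2)) (timeLaw κ) := hiu.sub hix
  have hdiff : steinSol μX μt h (x + u) - steinSol μX μt h x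
      = -∫ p, (h (Real.exp (-p.1) • (x + u) + p.2) - h p.2
        - (h (Real.exp (-p.1) • x + p.2) - h p.2)) ∂timeLaw κ := by
    rw [hs (x + u), hs x, integral_sub hiu hix]
    ring
  have hcomm : ∀ p : ℝ × EuclideanSpace ℝ (Fin d),
      Real.exp (-p.1) • x + p.2 + Real.exp (-p.1) • u = Real.exp (-p.1) • (x + u) + p.2 :=
    fun p => by rw [smul_add]; abel
  by_cases hu : ‖u‖ ≤ 1
  · obtain ⟨hi, he⟩ := integral_exp_smul_fderiv_apply κ hd h1 x u
    rw [if_pos hu, hdiff, (hasFDerivAt_steinSol κ hκ hself hε hmom hd h0 h1 x).fderiv,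
      neg_apply, he, ← neg_sub', ← integral_sub hA hi]
    simp only [if_pos hu, hcomm, sub_sub_sub_cancel_right]
  · rw [if_neg hu, hdiff]
    simp only [if_neg hu, hcomm, sub_sub_sub_cancel_right, sub_zero]

lemma real_inner_gradient (f : EuclideanSpace ℝ (Fin d) → ℝ) (x v : EuclideanSpace ℝ (Fin d)) :
    ⟪gradient f x, v⟫ = fderiv ℝ f x v := by
  rw [gradient, InnerProductSpace.toDual_symm_apply]

lemma steinSol_stein_equation {ν N : Measure (EuclideanSpace ℝ (Fin d))} [SFinite N]
    (hν : ν = ((volume.restrict (Ioi (0 : ℝ))).prod N).map (fun p => Real.exp (-p.1) • p.2))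
    (hJ : ∫⁻ u, ENNReal.ofReal (min 1 (‖u‖ ^ 2)) ∂ν < ∞) (hN : N {u | 1 < ‖u‖} < ∞)
    (c : EuclideanSpace ℝ (Fin d))
    (hκc : ∀ t, 0 ≤ t → ∀ ζ, charFun (κ t) ζ
      = Complex.exp (∫ s in (0 : ℝ)..t, levyExponent c N (Real.exp (-s) • ζ)))
    (hX : ∀ ζ, charFun μX ζ
      = Complex.exp (∫ s in Ioi (0 : ℝ), levyExponent c N (Real.exp (-s) • ζ)))
    (hκ : ∀ t, 0 ≤ t → κ t = μt t)
    (hself : ∀ t, 0 ≤ t → μX.map (fun z => Real.exp (-t) • z) ∗ μt t = μX)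
    (hε : ε ∈ Ioo (0 : ℝ) 1) (hmom : Integrable (fun z => ‖z‖ ^ ε) μX)
    (hd : ContDiff ℝ (⊤ : ℕ∞) h) (hs : HasCompactSupport h)
    (h0 : ∀ x, |h x| ≤ 1) (h1 : ∀ x, ‖fderiv ℝ h x‖ ≤ 1) (x : EuclideanSpace ℝ (Fin d)) :
    ⟪c - x, gradient (steinSol μX μt h) x⟫
        + ∫ u, (steinSol μX μt h (x + u) - steinSol μX μt h x
          - (if ‖u‖ ≤ 1 then ⟪gradient (steinSol μX μt h) x, u⟫ else 0)) ∂N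
      = h x - ∫ y, h y ∂μX := by
  have hd1 : ContDiff ℝ 1 h := hd.of_le (by exact_mod_cast le_top)
  obtain ⟨H, hHc, hH, hrep⟩ := exists_planeWave_representation hd hs
  have hmain := drift_add_jump_eq hν hJ hN c hκc hX (hd1.differentiable one_ne_zero) hHc hH hrep x
  rw [real_inner_comm, real_inner_gradient]
  simp only [real_inner_gradient,
    steinSol_compensated_increment κ hκ hself hε hmom hd1 h0 h1 x]
  rw [(hasFDerivAt_steinSol κ hκ hself hε hmom hd1 h0 h1 x).fderiv,
    neg_apply, (integral_exp_smul_fderiv_apply κ hd1 h1 x (c - x)).2,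
    integral_neg]
  linarith

end SteinSolution

/-- Existence, regularity and the Stein equation for the solution `f_h`
(`thm:Stein`). -/
theorem stmt6 {d : ℕ}
    (μX : Measure (EuclideanSpace ℝ (Fin d))) [IsProbabilityMeasure μX]
    (μt : ℝ → Measure (EuclideanSpace ℝ (Fin d)))
    (ν νt : Measure (EuclideanSpace ℝ (Fin d)))
    (σ : Measure (EuclideanSpace ℝ (Fin d))) [IsFiniteMeasure σ]
    (τ : EuclideanSpace ℝ (Fin d) → Measure ℝ)
    (b : EuclideanSpace ℝ (Fin d))
    (k : EuclideanSpace ℝ (Fin d) → ℝ → ℝ)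
    (ε β₁ β₂ β₃ : ℝ)
    (hnondeg : ∀ (v : EuclideanSpace ℝ (Fin d)) (c : ℝ), v ≠ 0 →
      μX {x : EuclideanSpace ℝ (Fin d) | ⟪v, x⟫ = c} ≠ 1)
    (hσ : σ {x : EuclideanSpace ℝ (Fin d) | ¬ ‖x‖ = 1} = 0)
    (hk0 : ∀ x, ∀ r : ℝ, 0 < r → 0 ≤ k x r)
    (hkcr : ∀ x, ContinuousOn (k x) (Ioi 0))
    (hkmono : ∀ x, AntitoneOn (k x) (Ioi 0))
    (hkcx : ∀ r : ℝ, 0 < r →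
      ContinuousOn (fun x => k x r) {x : EuclideanSpace ℝ (Fin d) | ‖x‖ = 1})
    (hklim0 : ∀ x, ‖x‖ = 1 → Tendsto (fun r => r ^ 2 * k x r) (𝓝[>] 0) (𝓝 0))
    (hkliminfty : ∀ x, ‖x‖ = 1 → Tendsto (k x) atTop (𝓝 0))
    (hpolar : ∀ g : EuclideanSpace ℝ (Fin d) → ℝ≥0∞, Measurable g →
      ∫⁻ u, g u ∂ν
        = ∫⁻ x, (∫⁻ r in Ioi (0 : ℝ), g (r • x) * ENNReal.ofReal (k x r / r)) ∂σ)
    (hτ : ∀ x : EuclideanSpace ℝ (Fin d),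
      (∀ a c : ℝ, 0 < a → a ≤ c → τ x (Ioc a c) = ENNReal.ofReal (k x a - k x c))
        ∧ τ x (Iic 0) = 0)
    (hνt : ∀ g : EuclideanSpace ℝ (Fin d) → ℝ≥0∞, Measurable g →
      ∫⁻ u, g u ∂νt = ∫⁻ x, (∫⁻ r, g (r • x) ∂(τ x)) ∂σ)
    (hchar : ∀ ξ, charFn μX ξ
      = Complex.exp (Complex.I * ((⟪b, ξ⟫ : ℝ) : ℂ)
          + ∫ u, (Complex.exp (Complex.I * ((⟪ξ, u⟫ : ℝ) : ℂ)) - 1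
              - (if ‖u‖ ≤ 1 then Complex.I * ((⟪ξ, u⟫ : ℝ) : ℂ) else 0)) ∂ν))
    (hμt0 : μt 0 = Measure.dirac 0)
    (hμtprob : ∀ t : ℝ, 0 ≤ t → IsProbabilityMeasure (μt t))
    (hμtchar : ∀ t : ℝ, 0 ≤ t → ∀ ξ,
      charFn (μt t) ξ = charFn μX ξ / charFn μX (Real.exp (-t) • ξ))
    -- moment assumptions
    (hε : ε ∈ Ioo (0 : ℝ) 1)
    (hXmom : ∫⁻ x, ENNReal.ofReal (‖x‖ ^ ε) ∂μX < ⊤)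
    (hβ₁ : 0 < β₁) (hβ₂ : 0 < β₂) (hβ₃ : β₃ ∈ Ioo (0 : ℝ) 1)
    (hγ₁ : ∃ γ₁ : ℝ, ∀ t : ℝ, 0 ≤ t →
      ∫⁻ x, (∫⁻ r in Ioi (1 : ℝ), ENNReal.ofReal (k x (Real.exp t * r) / r)) ∂σ
        ≤ ENNReal.ofReal (Real.exp (-β₁ * t) * γ₁))
    (hγ₂ : ∃ γ₂ : ℝ, ∀ t : ℝ, 0 ≤ t →
      ∫⁻ x, (∫⁻ r in Ioo (0 : ℝ) 1, ENNReal.ofReal (r * k x (Real.exp t * r))) ∂σ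
        ≤ ENNReal.ofReal (Real.exp (-β₂ * t) * γ₂))
    (hγ₃ : ∃ γ₃ : ℝ, ∀ t : ℝ, 0 ≤ t →
      ‖∫ x, (∫ r in (1 : ℝ)..Real.exp t, k x r) • x ∂σ‖
        ≤ Real.exp ((1 - β₃) * t) * γ₃)
    (hXtmom : ∃ M : ℝ, ∀ t : ℝ, 0 ≤ t →
      ∫⁻ y, ENNReal.ofReal (‖y‖ ^ ε) ∂(μt t) ≤ ENNReal.ofReal M) :
    -- (1) for `h ∈ H₁`, `f_h` is well defined and `C¹` with `M₁(f_h) ≤ 1`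
    (∀ h : EuclideanSpace ℝ (Fin d) → ℝ,
      ContDiff ℝ 1 h → (∀ x, |h x| ≤ 1) → (∀ x, ‖fderiv ℝ h x‖ ≤ 1) →
        (∀ x, IntegrableOn (fun t => Pop μt h t x - ∫ y, h y ∂μX) (Ioi 0) volume)
          ∧ ContDiff ℝ 1 (steinSol μX μt h)
          ∧ ∀ x, ‖fderiv ℝ (steinSol μX μt h) x‖ ≤ 1)
    ∧
    -- (2) for `h ∈ H₂ ∩ C_c^∞`, `f_h` is `C²`, `M₂(f_h) ≤ 1/2`, and solves the Stein equation
    (∀ h : EuclideanSpace ℝ (Fin d) → ℝ,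
      ContDiff ℝ (⊤ : ℕ∞) h → HasCompactSupport h →
      (∀ x, |h x| ≤ 1) → (∀ x, ‖fderiv ℝ h x‖ ≤ 1) →
      (∀ x, ‖iteratedFDeriv ℝ 2 h x‖ ≤ 1) →
        ContDiff ℝ 2 (steinSol μX μt h)
          ∧ (∀ x, ‖iteratedFDeriv ℝ 2 (steinSol μX μt h) x‖ ≤ 1 / 2)
          ∧ ∀ x, ⟪(b - ∫ y, k y 1 • y ∂σ) - x, gradient (steinSol μX μt h) x⟫
              + ∫ u, (steinSol μX μt h (x + u) - steinSol μX μt h x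
                  - (if ‖u‖ ≤ 1 then ⟪gradient (steinSol μX μt h) x, u⟫ else 0)) ∂νt
              = h x - ∫ y, h y ∂μX) := by
  have hτ0 : ∀ x, τ x (Iic 0) = 0 := fun x => (hτ x).2
  have hτa : ∀ x, ‖x‖ = 1 → ∀ a, 0 < a → τ x (Ioi a) = ENNReal.ofReal (k x a) :=
    fun x hx a ha => tail_measure_eq (hτ x).1 (hkliminfty x hx) ha
  have hN : ∀ a : ℝ, 0 < a → νt {u | a < ‖u‖} < ∞ := fun a ha =>
    measure_norm_gt_lt_top hσ hkcx hτ0 hτa hνt ha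
  have : SigmaFinite νt :=
    sigmaFinite_of_measure_norm_gt_lt_top (measure_singleton_zero hσ hτ0 hνt) hN
  have hν := levyMeasure_eq_map hσ hpolar hτ0 hτa hνt
  have hJ : ∫⁻ u, ENNReal.ofReal (min 1 (‖u‖ ^ 2)) ∂ν < ∞ := by
    obtain ⟨γ₁, hγ₁⟩ := hγ₁
    obtain ⟨γ₂, hγ₂⟩ := hγ₂
    have h1 := (hγ₁ 0 le_rfl).trans_lt ENNReal.ofReal_lt_top
    have h2 := (hγ₂ 0 le_rfl).trans_lt ENNReal.ofReal_lt_top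
    simp only [Real.exp_zero, one_mul] at h1 h2
    exact lintegral_min_one_norm_sq_lt_top hσ hpolar h1 h2
  have hmom : Integrable (fun z => ‖z‖ ^ ε) μX :=
    (lintegral_ofReal_ne_top_iff_integrable
      (measurable_norm.pow_const ε).aestronglyMeasurable
      (ae_of_all _ fun z => Real.rpow_nonneg (norm_nonneg z) ε)).1 hXmom.ne
  set c := b - ∫ y, k y 1 • y ∂σ with hc
  have hηi := integrableOn_levyExponent hν hJ (hN 1 one_pos) c
  have hη := continuous_levyExponent hν hJ (hN 1 one_pos) c
  have hX : ∀ ζ, charFun μX ζ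
      = Complex.exp (∫ s in Ioi (0 : ℝ), levyExponent c νt (Real.exp (-s) • ζ)) := fun ζ => by
    rw [hc, ← integral_annulus_eq hσ hk0 hkcx hτ0 hτa hνt,
      ← levyExponent_eq_integral hν hJ (hN 1 one_pos), charFun_eq_charFn, hchar]
    rfl
  have hXt : ∀ t : ℝ, 0 ≤ t → ∀ ζ, charFun (μt t) ζ
      = Complex.exp (∫ s in (0 : ℝ)..t, levyExponent c νt (Real.exp (-s) • ζ)) :=
    fun t ht ζ => charFun_eq_exp_intervalIntegral hηi hX hμtchar ht ζ
  have hself : ∀ t, 0 ≤ t → μX.map (fun z => Real.exp (-t) • z) ∗ μt t = μX := fun t ht => by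
    have := hμtprob t ht
    exact map_exp_smul_conv_eq (fun ξ => by rw [hX]; exact Complex.exp_ne_zero _) (hμtchar t ht)
  obtain ⟨κ, _, hκ⟩ := exists_kernel_of_continuousOn_charFun μt hμtprob
    (continuousOn_charFun_of_eq_exp hη hXt)
  refine ⟨fun h hd h0 h1 => ⟨integrableOn_Pop_sub_integral κ hκ hself hε hmom hd h0 h1,
    contDiff_one_steinSol κ hκ hself hε hmom hd h0 h1⟩, fun h hd hs h0 h1 h2 => ?_⟩
  obtain ⟨h3, h4⟩ := contDiff_two_steinSol κ hκ hself hε hmom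
    (hd.of_le (WithTop.coe_le_coe.2 le_top)) h0 h1 h2
  exact ⟨h3, h4, steinSol_stein_equation κ hν hJ (hN 1 one_pos) c
    (fun t ht ζ => by rw [hκ t ht, hXt t ht]) hX hκ hself hε hmom hd hs h0 h1⟩
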